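/- The only pairs (c, w) ∈ ℚ × ℚ satisfying −c³w² − 2c²w + 2cw² + c² − w² − c + w = 0 are (c, w) ∈ {(0, 0), (0, 1), (1, 0)}. -/

import Mathlib

open Polynomial NumberField

noncomputable def qZ : ℤ[X] := X^5 + (6*X^4 + 10*X^3 + 4*X^2 + 2)
noncomputable def qQ : ℚ[X] := X^5 + (6*X^4 + 10*X^3 + 4*X^2 + 2)

lemma qZ_natDegree : qZ.natDegree = 5 := by unfold qZ; compute_degree!
lemma qZ_monic : qZ.Monic := by
  unfold qZ
  apply monic_X_pow_add
  refine lt_of_le_of_lt (b := (4 : WithBot ℕ)) ?_ (by norm_num)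
  compute_degree
lemma qQ_natDegree : qQ.natDegree = 5 := by unfold qQ; compute_degree!
lemma qQ_monic : qQ.Monic := by
  unfold qQ
  apply monic_X_pow_add
  refine lt_of_le_of_lt (b := (4 : WithBot ℕ)) ?_ (by norm_num)
  compute_degree

lemma qZ_map : qZ.map (Int.castRingHom ℚ) = qQ := by
  simp [qZ, qQ]

lemma qZ_irred : Irreducible qZ := by
  have hE : qZ.IsEisensteinAt (Ideal.span {(2:ℤ)}) := by
    refine ⟨?_, ?_, ?_⟩
    · rw [qZ_monic.leadingCoeff, Ideal.mem_span_singleton]; norm_num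
    · intro n hn
      rw [qZ_natDegree] at hn
      rw [Ideal.mem_span_singleton]
      have h : ∀ n, qZ.coeff n = (if n = 5 then 1 else 0) + (6*(if n = 4 then 1 else 0)
          + 10*(if n = 3 then 1 else 0) + 4*(if n = 2 then 1 else 0) + 2*(if n = 0 then 1 else 0)) := by
        intro n
        unfold qZ
        simp only [coeff_add, coeff_X_pow, coeff_ofNat_mul]
        congr 2
        rw [show (2:ℤ[X]) = 2*1 by ring, coeff_ofNat_mul, coeff_one]
      rw [h]
      interval_cases n <;> norm_num
    · have : qZ.coeff 0 = 2 := by simp [qZ]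
      rw [this, Ideal.span_singleton_pow, Ideal.mem_span_singleton]; norm_num
  refine hE.irreducible ?_ qZ_monic.isPrimitive (by rw [qZ_natDegree]; norm_num)
  rw [Ideal.span_singleton_prime (by norm_num)]
  exact Int.prime_two

lemma qQ_irred : Irreducible qQ := by
  rw [← qZ_map]
  exact (Polynomial.IsPrimitive.Int.irreducible_iff_irreducible_map_cast qZ_monic.isPrimitive).1 qZ_irred

instance : Fact (Irreducible qQ) := ⟨qQ_irred⟩

abbrev KK := AdjoinRoot qQ

noncomputable def pbK : PowerBasis ℚ KK := AdjoinRoot.powerBasis qQ_irred.ne_zero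
lemma pbK_dim : pbK.dim = 5 := by
  rw [pbK, AdjoinRoot.powerBasis_dim, qQ_natDegree]
instance : NumberField KK where
  to_charZero := charZero_of_injective_algebraMap (algebraMap ℚ KK).injective
  to_finiteDimensional := pbK.finite

lemma finrankK : Module.finrank ℚ KK = 5 := by rw [pbK.finrank, pbK_dim]

lemma eval₂_qQ {R : Type*} [CommRing R] (f : ℚ →+* R) (x : R) :
    eval₂ f x qQ = x^5+6*x^4+10*x^3+4*x^2+2 := by
  unfold qQ
  simp only [eval₂_add, eval₂_mul, eval₂_X_pow, eval₂_ofNat]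
  ring

lemma root_eq : (AdjoinRoot.root qQ : KK)^5 + 6*(AdjoinRoot.root qQ)^4+10*(AdjoinRoot.root qQ)^3+4*(AdjoinRoot.root qQ)^2+2 = 0 := by
  have := AdjoinRoot.eval₂_root qQ
  rw [← eval₂_qQ (AdjoinRoot.of qQ), this]

noncomputable def piK : 𝓞 KK := ⟨AdjoinRoot.root qQ, by
  refine ⟨qZ, qZ_monic, ?_⟩
  have := root_eq
  simp [qZ, eval₂_add, eval₂_mul]
  linear_combination this⟩

lemma piK_eq : piK^5 + 6*piK^4+10*piK^3+4*piK^2+2 = 0 := by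
  apply RingOfIntegers.ext
  have := root_eq
  simp only [map_add, map_mul, map_pow, map_ofNat, map_zero]
  exact this

/-- general -/
lemma minpoly_pi : minpoly ℚ (AdjoinRoot.root qQ : KK) = qQ := by
  symm
  apply minpoly.eq_of_irreducible_of_monic qQ_irred ?_ qQ_monic
  rw [aeval_def, eval₂_qQ]
  exact root_eq

lemma norm_pi : Algebra.norm ℚ (AdjoinRoot.root qQ : KK) = -2 := by
  have h := Algebra.PowerBasis.norm_gen_eq_coeff_zero_minpoly pbK
  have hg : pbK.gen = AdjoinRoot.root qQ := rfl
  rw [hg, minpoly_pi, pbK_dim] at h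
  rw [h]
  norm_num [qQ]

open Polynomial NumberField
noncomputable def bK : Module.Basis (Fin 5) ℚ KK := pbK.basis.reindex (finCongr pbK_dim)
lemma bK_apply (i : Fin 5) : bK i = (AdjoinRoot.root qQ : KK)^(i:ℕ) := by
  simp [bK]
  rfl

def mK : Matrix (Fin 5) (Fin 5) ℚ := !![0,0,0,0,-2;1,0,0,0,0;0,1,0,0,-4;0,0,1,0,-10;0,0,0,1,-6]

lemma leftMul_root : Algebra.leftMulMatrix bK (AdjoinRoot.root qQ : KK) = mK := by
  have key : ∀ j : Fin 5, (AdjoinRoot.root qQ : KK) * bK j = ∑ i, mK i j • bK i := by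
    intro j
    have := root_eq
    fin_cases j <;> simp [Fin.sum_univ_succ, bK_apply, mK, Algebra.smul_def] <;> first | linear_combination this | ring1
  ext i j
  rw [Algebra.leftMulMatrix_eq_repr_mul, key]
  rw [Module.Basis.repr_sum_self]

lemma det5 : (5*mK^4+24*mK^3+30*mK^2+8*mK).det = 4432 := by
  have h2 : mK^2 = !![0,0,0,-2,12;0,0,0,0,-2;1,0,0,-4,24;0,1,0,-10,56;0,0,1,-6,26] := by
    rw [pow_two]; ext i j; fin_cases i <;> fin_cases j <;> norm_num [mK, Matrix.mul_apply, Fin.sum_univ_succ]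
  have h3 : mK^3 = !![0,0,-2,12,-52;0,0,0,-2,12;0,0,-4,24,-106;1,0,-10,56,-236;0,1,-6,26,-100] := by
    rw [pow_succ, h2]; ext i j
    fin_cases i <;> fin_cases j <;> norm_num [mK, Matrix.mul_apply, Fin.sum_univ_succ]
  have h4 : mK^4 = !![0,-2,12,-52,200;0,0,-2,12,-52;0,-4,24,-106,412;0,-10,56,-236,894;1,-6,26,-100,364] := by
    rw [pow_succ, h3]; ext i j
    fin_cases i <;> fin_cases j <;> norm_num [mK, Matrix.mul_apply, Fin.sum_univ_succ]
  have h5 : 5*mK^4+24*mK^3+30*mK^2+8*mK = !![0,-10,12,-32,96;8,0,-10,12,-32;30,-12,24,-74,204;24,-20,48,-136,406;5,-6,16,-48,152] := by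
    have e : 5*mK^4+24*mK^3+30*mK^2+8*mK = (5:ℚ)•mK^4+(24:ℚ)•mK^3+(30:ℚ)•mK^2+(8:ℚ)•mK := by
      simp only [Algebra.smul_def, map_ofNat]
    rw [e, h4, h3, h2]; ext i j
    fin_cases i <;> fin_cases j <;> norm_num [mK]
  rw [h5]
  simp [Matrix.det_succ_row_zero, Fin.sum_univ_succ, Fin.succAbove, Matrix.submatrix]
  norm_num

lemma discr_pb : |Algebra.discr ℚ pbK.basis| = 4432 := by
  have h := Algebra.discr_powerBasis_eq_norm ℚ pbK
  have hg : pbK.gen = AdjoinRoot.root qQ := rfl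
  rw [hg, minpoly_pi] at h
  have hd : derivative qQ = 5*X^4+24*X^3+30*X^2+8*X := by
    unfold qQ; simp only [derivative_add, derivative_mul, derivative_X_pow, derivative_ofNat]
    simp only [Nat.cast_ofNat, map_ofNat, Nat.reduceSub, pow_one, zero_mul, add_zero, zero_add]; ring
  have hn : Algebra.norm ℚ (aeval (AdjoinRoot.root qQ : KK) (derivative qQ)) = 4432 := by
    rw [hd, Algebra.norm_eq_matrix_det bK]
    simp only [map_add, map_mul, map_pow, aeval_X, map_ofNat, leftMul_root]
    exact det5
  rw [hn] at h
  rw [h, abs_mul, abs_pow]; norm_num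

lemma abs_discr_le : |discr KK| ≤ 4432 := by
  have hd := finrankK
  let ι := Module.Free.ChooseBasisIndex ℤ (𝓞 KK)
  let b := RingOfIntegers.basis KK
  have hc : Fintype.card ι = 5 := by
    rw [← finrankK, ← RingOfIntegers.rank KK]
    exact (Module.finrank_eq_card_chooseBasisIndex ℤ (𝓞 KK)).symm
  let e : Fin 5 ≃ ι := (Fintype.equivFinOfCardEq hc).symm
  let b5 : Module.Basis (Fin 5) ℤ (𝓞 KK) := b.reindex e.symm
  have h1 : Algebra.discr ℤ b5 = discr KK := discr_eq_discr KK b5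
  let v : Fin 5 → 𝓞 KK := fun i => piK^(i:ℕ)
  have h2 : v = Matrix.vecMul b5 ((b5.toMatrix v).map (algebraMap ℤ (𝓞 KK))) := by
    exact (b5.toMatrix_map_vecMul v).symm
  have h3 : Algebra.discr ℤ v = (b5.toMatrix v).det^2 * discr KK := by
    rw [← h1, ← Algebra.discr_of_matrix_vecMul, ← h2]
  have h4 : |((Algebra.discr ℤ v : ℤ):ℚ)| = 4432 := by
    rw [← discr_pb]
    have hr : Algebra.discr ℚ pbK.basis = Algebra.discr ℚ bK := by
      rw [← Algebra.discr_reindex ℚ pbK.basis (finCongr pbK_dim)]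
      congr 1
      ext i; simp [bK]
    rw [hr, Algebra.discr_def, Algebra.discr_def]
    congr 1
    rw [← eq_intCast (Int.castRingHom ℚ), RingHom.map_det]
    congr 1
    ext i j
    simp only [RingHom.mapMatrix_apply, Matrix.map_apply, Algebra.traceMatrix_apply, Algebra.traceForm_apply, eq_intCast]
    rw [Algebra.coe_trace_int, bK_apply, bK_apply]
    simp only [v, map_mul, map_pow]
    rfl
  have h5 : |Algebra.discr ℤ v| = 4432 := by exact_mod_cast h4
  rw [h3, abs_mul] at h5
  have h6 : (b5.toMatrix v).det ≠ 0 := by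
    intro h; rw [h] at h5; norm_num at h5
  have h7 : 1 ≤ |(b5.toMatrix v).det^2| := Int.one_le_abs (pow_ne_zero 2 h6)
  nlinarith [abs_nonneg (discr KK)]

open Polynomial NumberField

lemma zeta_pows {R : Type*} [CommRing R] (p z : R) (hp : p^5+6*p^4+10*p^3+4*p^2+2=0)
    (hz : z = -4+4*p-13*p^2-18*p^3-4*p^4) :
    z^2 = -8+8*p-24*p^2-32*p^3-7*p^4 ∧ z^3 = 4+2*p+4*p^2+8*p^3+2*p^4 ∧
    z^4 = 40-20*p+92*p^2+126*p^3+28*p^4 ∧ z^5 = 60-32*p+144*p^2+184*p^3+40*p^4 := by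
  have h2 : z^2 = -8+8*p-24*p^2-32*p^3-7*p^4 := by
    rw [hz]; linear_combination (12-20*p+48*p^2+16*p^3)*hp
  have h3 : z^3 = 4+2*p+4*p^2+8*p^3+2*p^4 := by
    rw [pow_succ, h2, hz]; linear_combination (14-33*p+86*p^2+28*p^3)*hp
  have h4 : z^4 = 40-20*p+92*p^2+126*p^3+28*p^4 := by
    rw [pow_succ, h3, hz]; linear_combination (-28+14*p-20*p^2-8*p^3)*hp
  refine ⟨h2, h3, h4, ?_⟩
  rw [pow_succ, h4, hz]; linear_combination (-110+136*p-336*p^2-112*p^3)*hp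

lemma zetaP_id {R : Type*} [CommRing R] (p z : R) (hp : p^5+6*p^4+10*p^3+4*p^2+2=0)
    (hz : z = -4+4*p-13*p^2-18*p^3-4*p^4) :
    z^5-4*z^4+8*z^3-8*z^2+4 = 0 ∧ 2*p = -4+4*z-2*z^2+z^3 := by
  obtain ⟨h2, h3, h4, h5⟩ := zeta_pows p z hp hz
  rw [h5, h4, h3, h2, hz]
  constructor <;> ring

lemma realroot_unique (s t : ℝ) (hs : s^5-4*s^4+8*s^3-8*s^2+4 = 0) (ht : t^5-4*t^4+8*t^3-8*t^2+4 = 0) : s = t := by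
  have neg : ∀ t : ℝ, t^5-4*t^4+8*t^3-8*t^2+4 = 0 → t < 0 := by
    intro t ht
    by_contra h
    push Not at h
    have e : t*(2-t)^4+4*(1-t)^4 = 0 := by linear_combination 1*ht + 0
    have h1 : 0 ≤ t*(2-t)^4 := by positivity
    have h2 : 0 ≤ 4*(1-t)^4 := by positivity
    have h3 : (1-t)^4 = 0 := by linarith
    have h4 : 1 - t = 0 := by simpa using h3
    have h5 : t = 1 := by linarith
    subst h5; norm_num at e
  have mono : ∀ s t : ℝ, t < 0 → s < t → s^5-4*s^4+8*s^3-8*s^2+4 < t^5-4*t^4+8*t^3-8*t^2+4 := by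
    intro s t ht hst
    obtain ⟨a, rfl⟩ : ∃ a, s = -a := ⟨-s, by ring⟩
    obtain ⟨b, rfl⟩ : ∃ b, t = -b := ⟨-t, by ring⟩
    have hb : 0 < b := by linarith
    have hab : b < a := by linarith
    have e5 : b^5 < a^5 := by gcongr
    have e4 : b^4 < a^4 := by gcongr
    have e3 : b^3 < a^3 := by gcongr
    have e2 : b^2 < a^2 := by gcongr
    nlinarith
  rcases lt_trichotomy s t with h | h | h
  · have := mono s t (neg t ht) h; linarith
  · exact h
  · have := mono t s (neg s hs) h; linarith

lemma realroot_q_unique (s t : ℝ) (hs : s^5+6*s^4+10*s^3+4*s^2+2=0) (ht : t^5+6*t^4+10*t^3+4*t^2+2=0) : s = t := by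
  obtain ⟨h1, h2⟩ := zetaP_id s _ hs rfl
  obtain ⟨h3, h4⟩ := zetaP_id t _ ht rfl
  have h := realroot_unique _ _ h1 h3
  rw [h] at h2
  linarith

open InfinitePlace Classical in
lemma nrReal : nrRealPlaces KK = 1 := by
  have h1 : 0 < nrRealPlaces KK := nrRealPlaces_pos_of_odd_finrank (by rw [finrankK]; decide)
  have h2 : nrRealPlaces KK ≤ 1 := by
    rw [← card_real_embeddings, Fintype.card_le_one_iff]
    rintro ⟨φ, hφ⟩ ⟨ψ, hψ⟩
    have key : ∀ (φ : KK →+* ℂ) (h : ComplexEmbedding.IsReal φ), 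
      (h.embedding (AdjoinRoot.root qQ))^5+6*(h.embedding (AdjoinRoot.root qQ))^4+10*(h.embedding (AdjoinRoot.root qQ))^3
        +4*(h.embedding (AdjoinRoot.root qQ))^2+2=0 := by
      intro φ h
      have := congrArg h.embedding root_eq
      simpa only [map_add, map_mul, map_pow, map_ofNat, map_zero] using this
    have e := realroot_q_unique _ _ (key φ hφ) (key ψ hψ)
    have e2 : φ (AdjoinRoot.root qQ) = ψ (AdjoinRoot.root qQ) := by
      rw [← ComplexEmbedding.IsReal.coe_embedding_apply hφ, ← ComplexEmbedding.IsReal.coe_embedding_apply hψ, e]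
    apply Subtype.ext
    apply AdjoinRoot.ringHom_ext
    · exact Subsingleton.elim _ _
    · exact e2
  omega

open InfinitePlace in
lemma nrComplex : nrComplexPlaces KK = 2 := by
  have := card_add_two_mul_card_eq_rank KK
  rw [finrankK, nrReal] at this
  omega

open InfinitePlace in
lemma unitRank : Units.rank KK = 2 := by
  rw [Units.rank, card_eq_nrRealPlaces_add_nrComplexPlaces, nrReal, nrComplex]

lemma minkowski_lt : (4 / Real.pi) ^ (InfinitePlace.nrComplexPlaces KK) *
      ((Module.finrank ℚ KK).factorial / (Module.finrank ℚ KK : ℝ) ^ (Module.finrank ℚ KK) * √|(discr KK : ℝ)|) < 5 := by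
  rw [nrComplex, finrankK]
  have h1 : √|(discr KK : ℝ)| ≤ 67 := by
    rw [Real.sqrt_le_left (by norm_num)]
    have : (|discr KK| : ℝ) ≤ 4432 := by exact_mod_cast abs_discr_le
    linarith
  have h2 : 4 / Real.pi ≤ 4/3.14 := by
    have := Real.pi_gt_d2
    gcongr
  have h0 : 0 ≤ 4 / Real.pi := by positivity
  calc _ ≤ (4/3.14)^2 * (((5:ℕ).factorial : ℝ) / ((5:ℕ):ℝ)^5 * 67) := by gcongr
    _ < 5 := by norm_num [Nat.factorial]

lemma absNorm_pi : Ideal.absNorm (Ideal.span {piK}) = 2 := by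
  rw [Ideal.absNorm_span_singleton]
  have : Algebra.norm ℤ piK = -2 := by
    have := Algebra.coe_norm_int piK
    have h2 : ((piK : 𝓞 KK) : KK) = AdjoinRoot.root qQ := rfl
    rw [h2, norm_pi] at this
    exact_mod_cast this
  rw [this]; rfl

lemma pi_or (x : 𝓞 KK) : piK ∣ x ∨ piK ∣ x - 1 := by
  have h := absNorm_pi
  rw [Ideal.absNorm_apply, Submodule.cardQuot_apply] at h
  have h0 : ¬ (piK ∣ 1) := by
    intro h1
    rw [← Ideal.mem_span_singleton, ← Ideal.eq_top_iff_one] at h1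
    have := absNorm_pi
    rw [h1] at this
    simp at this
  by_contra! hx
  rw [← Ideal.mem_span_singleton, ← Ideal.mem_span_singleton] at hx
  rw [← Ideal.mem_span_singleton] at h0
  have hfin : Finite (𝓞 KK ⧸ Ideal.span {piK}) := Nat.finite_of_card_ne_zero (by rw [h]; norm_num)
  have := Fintype.ofFinite (𝓞 KK ⧸ Ideal.span {piK})
  rw [Nat.card_eq_fintype_card] at h
  have h3 : 2 < Fintype.card (𝓞 KK ⧸ Ideal.span {piK}) := by
    rw [Fintype.two_lt_card_iff]
    refine ⟨0, 1, Ideal.Quotient.mk _ x, ?_, ?_, ?_⟩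
    · intro hh; apply h0; rw [← Ideal.Quotient.eq_zero_iff_mem]; simpa using hh.symm
    · intro hh; apply hx.1; rw [← Ideal.Quotient.eq_zero_iff_mem]; simpa using hh.symm
    · intro hh; apply hx.2; rw [← Ideal.Quotient.eq_zero_iff_mem, map_sub, ← hh]; simp
  omega

lemma pi_prime : Prime piK := by
  have : (Ideal.span {piK}).IsPrime := by
    apply Ideal.isPrime_of_irreducible_absNorm
    rw [absNorm_pi]
    exact Nat.prime_two
  rw [Ideal.span_singleton_prime] at this
  · exact this
  · intro h
    have := absNorm_pi
    rw [h] at this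
    simp at this

lemma two_eq : (2:𝓞 KK) * (1+2*piK^2+5*piK^3+3*piK^4) = -piK^5 := by
  linear_combination piK_eq

lemma pid : IsPrincipalIdealRing (𝓞 KK) := by
  apply RingOfIntegers.isPrincipalIdealRing_of_isPrincipal_of_norm_le_of_isPrime
  rintro ⟨I, hI0⟩ hI hn
  have h5 : (Ideal.absNorm I : ℝ) < 5 := lt_of_le_of_lt hn minkowski_lt
  have h5' : Ideal.absNorm I < 5 := by exact_mod_cast h5
  simp only at hI ⊢
  have hne1 : Ideal.absNorm I ≠ 1 := by
    rw [Ne, Ideal.absNorm_eq_one_iff]; exact hI.ne_top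
  have hne0 : Ideal.absNorm I ≠ 0 := Ideal.absNorm_ne_zero_of_nonZeroDivisors ⟨I, hI0⟩
  have hmem := Ideal.absNorm_mem I
  have two : (2:𝓞 KK) ∈ I → I.IsPrincipal := by
    intro h
    have h1 : piK^5 ∈ I := by
      have := I.mul_mem_right (-(1+2*piK^2+5*piK^3+3*piK^4)) h
      rwa [mul_neg, two_eq, neg_neg] at this
    have h2 := hI.mem_of_pow_mem 5 h1
    have h3 : Ideal.span {piK} ≤ I := by rwa [Ideal.span_singleton_le_iff_mem]
    have hmax : (Ideal.span {piK}).IsMaximal := by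
      apply Ideal.IsPrime.isMaximal
      · rw [Ideal.span_singleton_prime pi_prime.ne_zero]; exact pi_prime
      · simpa using pi_prime.ne_zero
    have := hmax.eq_of_le hI.ne_top h3
    rw [← this]
    exact ⟨⟨piK, rfl⟩⟩
  interval_cases h : Ideal.absNorm I
  · omega
  · omega
  · exact two (by simpa using hmem)
  · exfalso
    rw [Ideal.absNorm_apply, Submodule.cardQuot_apply] at h
    have hfin : Finite (𝓞 KK ⧸ I) := Nat.finite_of_card_ne_zero (by rw [h]; norm_num)
    have := Fintype.ofFinite (𝓞 KK ⧸ I)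
    rw [Nat.card_eq_fintype_card] at h
    have e := (ZMod.ringEquivOfPrime (𝓞 KK ⧸ I) Nat.prime_three h).symm
    have := congrArg (e : (𝓞 KK ⧸ I) →+* ZMod 3) (congrArg (Ideal.Quotient.mk I) piK_eq)
    simp only [map_add, map_mul, map_pow, map_ofNat, map_zero] at this
    generalize ((e : (𝓞 KK ⧸ I) →+* ZMod 3) (Ideal.Quotient.mk I piK)) = y at this
    revert y; decide
  · apply two
    have : (2:𝓞 KK)*2 ∈ I := by norm_num; simpa using hmem
    rcases hI.mem_or_mem this with h | h <;> exact h

open Polynomial NumberField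

abbrev OK := 𝓞 KK

noncomputable def eK : OK := 39+58*piK+22*piK^2-piK^3-piK^4

lemma two_eq' : (2:OK) = piK^5*eK := by
  unfold eK
  linear_combination (1 - 2*piK^2 - 5*piK^3 + piK^4)*piK_eq

lemma pi_dvd_two : piK ∣ 2 := by
  rw [two_eq']; exact Dvd.dvd.mul_right (dvd_pow_self _ (by norm_num)) _

lemma pi_dvd_int (n : ℤ) : piK ∣ (n:OK) ↔ 2 ∣ n := by
  constructor
  · intro h
    by_contra h2
    obtain ⟨m, rfl⟩ : ∃ m, n = 2*m+1 := ⟨n/2, by omega⟩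
    push_cast at h
    rw [dvd_add_right (pi_dvd_two.mul_right _)] at h
    exact pi_prime.not_isUnit (isUnit_of_dvd_one h)
  · rintro ⟨m, rfl⟩
    push_cast
    exact pi_dvd_two.mul_right _

lemma pi_dvd_int_add (n : ℤ) (y : OK) (h : piK ∣ (n:OK) + piK*y) : ∃ m : ℤ, n = 2*m := by
  rw [dvd_add_left (Dvd.intro _ rfl), pi_dvd_int] at h
  exact h

/-- reduction step -/
lemma step (k : ℕ) (n : ℤ) (y : OK) (h : piK^(k+1) ∣ (n:OK) + piK*y) :
    ∃ m : ℤ, n = 2*m ∧ piK^k ∣ y + m*piK^4*eK := by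
  obtain ⟨m, rfl⟩ := pi_dvd_int_add n y (dvd_trans (dvd_pow_self _ (by omega)) h)
  refine ⟨m, rfl, ?_⟩
  obtain ⟨w, hw⟩ := h
  refine ⟨w, mul_left_cancel₀ pi_prime.ne_zero ?_⟩
  push_cast at hw
  rw [two_eq'] at hw
  linear_combination hw

lemma six (n0 n1 n2 n3 n4 n5 : ℤ) (y : OK)
    (h : piK^6 ∣ (n0:OK) + n1*piK+n2*piK^2+n3*piK^3+n4*piK^4+n5*piK^5+piK^6*y) :
    (2 ∣ n0 ∧ 2 ∣ n1 ∧ 2 ∣ n2 ∧ 2 ∣ n3 ∧ 2 ∣ n4) ∧ ∃ m, n0 = 2*m ∧ 2 ∣ m + n5 := by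
  obtain ⟨m0, rfl, g0⟩ := step 5 n0 (n1+n2*piK+n3*piK^2+n4*piK^3+n5*piK^4+piK^5*y) (by convert h using 1; ring)
  obtain ⟨m1, rfl, g1⟩ := step 4 n1 (n2+n3*piK+n4*piK^2+n5*piK^3+piK^4*y+m0*piK^3*eK) (by convert g0 using 1; ring)
  obtain ⟨m2, rfl, g2⟩ := step 3 n2 (n3+n4*piK+n5*piK^2+piK^3*y+m0*piK^2*eK+m1*piK^3*eK) (by convert g1 using 1; ring)
  obtain ⟨m3, rfl, g3⟩ := step 2 n3 (n4+n5*piK+piK^2*y+m0*piK*eK+m1*piK^2*eK+m2*piK^3*eK) (by convert g2 using 1; ring)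
  obtain ⟨m4, rfl, g4⟩ := step 1 n4 (n5+piK*y+m0*eK+m1*piK*eK+m2*piK^2*eK+m3*piK^3*eK) (by convert g3 using 1; ring)
  obtain ⟨m5, h5, g5⟩ := step 0 (n5 + 39*m0) (y+m0*(58+22*piK-piK^2-piK^3)+m1*eK+m2*piK*eK+m3*piK^2*eK+m4*piK^3*eK) (by
    convert g4 using 1; unfold eK; push_cast; ring)
  refine ⟨by simp, m0, rfl, by omega⟩

lemma odd_form (x : OK) (h : ¬ piK ∣ x) : ∃ y, x = 1 + piK*y := by
  obtain ⟨y, hy⟩ := (pi_or x).resolve_left h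
  exact ⟨y, by linear_combination hy⟩

lemma digit (x : OK) : ∃ (n : ℤ) (y : OK), (n = 0 ∨ n = 1) ∧ x = n + piK*y := by
  rcases pi_or x with ⟨y, hy⟩ | ⟨y, hy⟩
  · exact ⟨0, y, Or.inl rfl, by rw [hy]; simp⟩
  · exact ⟨1, y, Or.inr rfl, by push_cast; linear_combination hy⟩

lemma sq_form (x : OK) (h : ¬ piK ∣ x) : ∃ (n m : ℤ) (y : OK), x^2 = 1+n*piK^2+m*piK^4 + piK^6*y := by
  obtain ⟨y, rfl⟩ := odd_form x h
  obtain ⟨n, y, hn, rfl⟩ := digit y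
  obtain ⟨m, y, hm, rfl⟩ := digit y
  have hn2 : (n:OK)^2 = n := by rcases hn with rfl | rfl <;> simp
  have hm2 : (m:OK)^2 = m := by rcases hm with rfl | rfl <;> simp
  refine ⟨n, m, y^2 + eK*(n+m*piK+piK^2*y+n*m*piK^2+n*piK^3*y+m*piK^4*y), ?_⟩
  linear_combination piK^2*hn2+piK^4*hm2+(n*piK+m*piK^2+piK^3*y+n*m*piK^3+n*piK^4*y+m*piK^5*y)*two_eq'

noncomputable def u1 : OKˣ := ⟨-1-piK, 1-piK+5*piK^2+5*piK^3+piK^4, by linear_combination -piK_eq, by linear_combination -piK_eq⟩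
noncomputable def u2 : OKˣ := ⟨-1-piK^2-piK^3, 11-8*piK+31*piK^2+41*piK^3+9*piK^4,
  by linear_combination (-6+4*piK-9*piK^2)*piK_eq, by linear_combination (-6+4*piK-9*piK^2)*piK_eq⟩

lemma indep (a b c : Fin 2) (s t : OK) (hs : ¬ piK ∣ s) (ht : ¬ piK ∣ t)
    (h : piK^6 ∣ (((-1)^(a:ℕ) * u1^(b:ℕ) * u2^(c:ℕ) : OKˣ) : OK) * s^2 - t^2) : a = 0 ∧ b = 0 ∧ c = 0 := by
  obtain ⟨n1, n2, y, hy⟩ := sq_form s hs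
  obtain ⟨m1, m2, w, hw⟩ := sq_form t ht
  rw [hy, hw] at h
  push_cast at h
  obtain ⟨e, he, hE⟩ : ∃ e : ℤ, (e = 1 ∨ e = -1) ∧ ((-1:OK)^(a:ℕ) = e) := by
    fin_cases a
    · exact ⟨1, by simp, by simp⟩
    · exact ⟨-1, by simp, by simp⟩
  have hE0 := hE
  rw [hE] at h
  have h1 : (u1 : OK) = -1-piK := rfl
  have h2 : (u2 : OK) = -1-piK^2-piK^3 := rfl
  rw [h1, h2] at h
  fin_cases b <;> fin_cases c <;> simp only [Fin.zero_eta, Fin.mk_one, Fin.val_zero, Fin.val_one, pow_zero, pow_one, mul_one] at h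
  · refine ⟨?_, rfl, rfl⟩
    fin_cases a
    · rfl
    · exfalso
      have : e = -1 := by
        have : ((-1 : ℤ) : OK) = e := by rw [← hE]; simp
        exact_mod_cast this.symm
      subst this
      obtain ⟨-, m, hm, hm2⟩ := six (-2) 0 (-n1-m1) 0 (-n2-m2) 0 (-y-w) (by convert h using 1; push_cast; ring)
      omega
  · exfalso
    obtain ⟨⟨-,-,-,hh,-⟩,-⟩ := six (-e-1) 0 (-e*(1+n1)-m1) (-e) (-e*(n1+n2)-m2) (-e*n1)
      (-e*(n2+n2*piK)-e*(1+piK^2+piK^3)*y-w) (by convert h using 1; push_cast; ring)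
    omega
  · exfalso
    obtain ⟨⟨-,hh,-,-,-⟩,-⟩ := six (-e-1) (-e) (-e*n1-m1) (-e*n1) (-e*n2-m2) (-e*n2)
      (-e*(1+piK)*y-w) (by convert h using 1; push_cast; ring)
    omega
  · exfalso
    obtain ⟨⟨-,hh,-,-,-⟩,-⟩ := six (e-1) (e) (e*(1+n1)-m1) (e*(2+n1)) (e*(1+n1+n2)-m2) (e*(2*n1+n2))
      (e*(n1+n2+2*n2*piK+n2*piK^2)+e*(1+piK+piK^2+2*piK^3+piK^4)*y-w) (by convert h using 1; push_cast; ring)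
    omega

lemma unit_rep : ∃ f0 f1 : OKˣ, ∀ x : OKˣ, ∃ (d : ℕ) (e0 e1 : ℤ), x = (-1)^d * f0^e0 * f1^e1 := by
  let g := finCongr unitRank
  refine ⟨Units.fundSystem KK (g.symm 0), Units.fundSystem KK (g.symm 1), fun x => ?_⟩
  obtain ⟨⟨t, e⟩, h, -⟩ := Units.exist_unique_eq_mul_prod KK x
  have hp : ∏ i, (Units.fundSystem KK i)^(e i) = Units.fundSystem KK (g.symm 0)^(e (g.symm 0)) * Units.fundSystem KK (g.symm 1)^(e (g.symm 1)) := by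
    rw [← g.symm.prod_comp, Fin.prod_univ_two]
  simp only at h
  rw [hp, ← mul_assoc] at h
  rcases Units.torsion_eq_one_or_neg_one_of_odd_finrank (by rw [finrankK]; decide) t with ht | ht
  · exact ⟨0, _, _, by rw [h, ht, pow_zero]⟩
  · exact ⟨1, _, _, by rw [h, ht, pow_one]⟩

lemma sq_aux {G : Type*} [CommGroup G] (ε f0 f1 x x' : G) (d d' k1 : ℕ) (e0 e1 e0' e1' k2 k3 : ℤ)
    (hx : x = ε^d*f0^e0*f1^e1) (hx' : x' = ε^d'*f0^e0'*f1^e1') (h1 : d + d' = 2*k1)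
    (h2 : e0' = e0 + 2*k2) (h3 : e1' = e1 + 2*k3) : ∃ W : G, x*x' = W^2 := by
  refine ⟨ε^k1*f0^(e0+k2)*f1^(e1+k3), ?_⟩
  have a1 : ε^d*ε^d' = (ε^k1)^2 := by rw [← pow_add, h1, ← pow_mul, mul_comm]
  have a2 : f0^e0*f0^e0' = (f0^(e0+k2))^2 := by
    rw [← zpow_add, pow_two, ← zpow_add, h2]; congr 1; ring
  have a3 : f1^e1*f1^e1' = (f1^(e1+k3))^2 := by
    rw [← zpow_add, pow_two, ← zpow_add, h3]; congr 1; ring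
  rw [hx, hx', mul_pow, mul_pow, ← a1, ← a2, ← a3, mul_mul_mul_comm, mul_mul_mul_comm (ε^d)]

lemma sq_aux2 {G : Type*} [CommGroup G] (a b c d a' b' c' d' A B C D y0 y1 y2 y3 W : G)
    (h0 : a*a' = A*y0^2) (h1 : b*b' = B*y1^2) (h2 : c*c' = C*y2^2) (h3 : d*d' = D*y3^2)
    (hW : (a*b*c*d)*(a'*b'*c'*d') = W^2) : ∃ Z : G, A*B*C*D = Z^2 := by
  refine ⟨W * (y0*y1*y2*y3)⁻¹, ?_⟩
  rw [mul_pow, ← hW, inv_pow, eq_mul_inv_iff_mul_eq, mul_pow, mul_pow, mul_pow, mul_mul_mul_comm (a*b*c),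
    mul_mul_mul_comm (a*b), mul_mul_mul_comm a, h0, h1, h2, h3, mul_mul_mul_comm (A*B*C),
    mul_mul_mul_comm (A*B), mul_mul_mul_comm A]

lemma unit_square (u : OKˣ) (s t : OK) (hs : ¬ piK ∣ s) (ht : ¬ piK ∣ t) (h : piK^6 ∣ u*s^2 - t^2) :
    ∃ w : OKˣ, u = w^2 := by
  obtain ⟨f0, f1, hf⟩ := unit_rep
  choose d e0 e1 hx using hf
  let g : Fin 2 × Fin 2 × Fin 2 × Fin 2 → OKˣ := fun p => (-1)^(p.1:ℕ)*u1^(p.2.1:ℕ)*u2^(p.2.2.1:ℕ)*u^(p.2.2.2:ℕ)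
  let φ : Fin 2 × Fin 2 × Fin 2 × Fin 2 → ZMod 2 × ZMod 2 × ZMod 2 :=
    fun p => ((d (g p) : ZMod 2), (e0 (g p) : ZMod 2), (e1 (g p) : ZMod 2))
  obtain ⟨p, p', hne, heq⟩ := Fintype.exists_ne_map_eq_of_card_lt φ (by simp [Fintype.card_prod, ZMod.card])
  simp only [φ, Prod.mk.injEq] at heq
  obtain ⟨q1, q2, q3⟩ := heq
  have q1' := (ZMod.natCast_eq_natCast_iff' _ _ _).1 q1
  have q2' := (ZMod.intCast_eq_intCast_iff_dvd_sub _ _ _).1 q2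
  have q3' := (ZMod.intCast_eq_intCast_iff_dvd_sub _ _ _).1 q3
  obtain ⟨k2, hk2⟩ := q2'
  obtain ⟨k3, hk3⟩ := q3'
  have hsq : ∃ W : OKˣ, g p * g p' = W^2 := by
    obtain ⟨k1, hk1⟩ : ∃ k1, d (g p) + d (g p') = 2*k1 := ⟨(d (g p) + d (g p'))/2, by omega⟩
    have e2 : e0 (g p') = e0 (g p) + 2*k2 := by push_cast at hk2; linarith
    have e3 : e1 (g p') = e1 (g p) + 2*k3 := by push_cast at hk3; linarith
    exact sq_aux _ _ _ _ _ _ _ _ _ _ _ _ _ _ (hx (g p)) (hx (g p')) hk1 e2 e3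
  have red : ∀ (x : OKˣ) (i j : Fin 2), ∃ y : OKˣ, x^(i:ℕ) * x^(j:ℕ) = x^((i+j : Fin 2):ℕ) * y^2 := by
    intro x i j
    fin_cases i <;> fin_cases j
    · exact ⟨1, by simp⟩
    · exact ⟨1, by simp⟩
    · exact ⟨1, by simp⟩
    · exact ⟨x, by simp [pow_two]⟩
  obtain ⟨W, hW⟩ := hsq
  obtain ⟨y0, hy0⟩ := red (-1) p.1 p'.1
  obtain ⟨y1, hy1⟩ := red u1 p.2.1 p'.2.1
  obtain ⟨y2, hy2⟩ := red u2 p.2.2.1 p'.2.2.1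
  obtain ⟨y3, hy3⟩ := red u p.2.2.2 p'.2.2.2
  have hZ : ∃ Z : OKˣ, (-1)^((p.1+p'.1 : Fin 2):ℕ) * u1^((p.2.1+p'.2.1 : Fin 2):ℕ) * u2^((p.2.2.1+p'.2.2.1 : Fin 2):ℕ)
      * u^((p.2.2.2+p'.2.2.2 : Fin 2):ℕ) = Z^2 := by
    exact sq_aux2 _ _ _ _ _ _ _ _ _ _ _ _ _ _ _ _ _ hy0 hy1 hy2 hy3 hW
  obtain ⟨Z, hZ⟩ := hZ
  have hne' : ¬ (p.1+p'.1 = 0 ∧ p.2.1+p'.2.1 = 0 ∧ p.2.2.1+p'.2.2.1 = 0 ∧ p.2.2.2+p'.2.2.2 = 0) := by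
    rintro ⟨h1, h2, h3, h4⟩
    apply hne
    have : ∀ i j : Fin 2, i + j = 0 → i = j := by decide
    exact Prod.ext (this _ _ h1) (Prod.ext (this _ _ h2) (Prod.ext (this _ _ h3) (this _ _ h4)))
  generalize p.1+p'.1 = a at *
  generalize p.2.1+p'.2.1 = b at *
  generalize p.2.2.1+p'.2.2.1 = c at *
  generalize p.2.2.2+p'.2.2.2 = f at *
  have hZodd : ¬ piK ∣ (Z:OK) := fun hh => pi_prime.not_isUnit (isUnit_of_dvd_unit hh Z.isUnit)
  have key : a = 0 ∧ b = 0 ∧ c = 0 := by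
    fin_cases f
    · apply indep a b c 1 Z (fun h => pi_prime.not_isUnit (isUnit_of_dvd_one h)) hZodd
      have : ((-1)^(a:ℕ) * u1^(b:ℕ) * u2^(c:ℕ) : OKˣ) = Z^2 := by rw [← hZ]; simp
      rw [this]; simp
    · apply indep a b c t (Z*s) ht (by
        intro hh; rcases pi_prime.dvd_or_dvd hh with h | h
        · exact hZodd h
        · exact hs h)
      have : ((-1)^(a:ℕ) * u1^(b:ℕ) * u2^(c:ℕ) : OKˣ) * u = Z^2 := by rw [← hZ]; simp
      have h' := congrArg (fun x : OKˣ => (x : OK)) this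
      simp only [Units.val_mul ((-1)^(a:ℕ) * u1^(b:ℕ) * u2^(c:ℕ) : OKˣ) u] at h'
      generalize (((-1)^(a:ℕ) * u1^(b:ℕ) * u2^(c:ℕ) : OKˣ) : OK) = E at *
      obtain ⟨k, hk⟩ := h
      refine ⟨-E*k, ?_⟩
      push_cast at h'
      linear_combination s^2*h' - E*hk
  obtain ⟨rfl, rfl, rfl⟩ := key
  have hf : f = 1 := by
    have : ∀ f : Fin 2, f ≠ 0 → f = 1 := by decide
    exact this f (fun h => hne' ⟨rfl, rfl, rfl, h⟩)
  subst hf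
  exact ⟨Z, by rw [← hZ]; simp⟩

open Polynomial

/-- explicit sextic -/
noncomputable def q6 (c0 c1 c2 c3 c4 c5 c6 : ℤ) : ℤ[X] :=
  (c0:ℤ[X]) + c1 * (X:ℤ[X]) + c2 * (X:ℤ[X])^2 + c3 * (X:ℤ[X])^3 + c4 * (X:ℤ[X])^4 + c5 * (X:ℤ[X])^5 + c6 * (X:ℤ[X])^6

lemma q6_coeff (c0 c1 c2 c3 c4 c5 c6 : ℤ) (n : ℕ) : (q6 c0 c1 c2 c3 c4 c5 c6).coeff n =
    if n = 0 then c0 else if n = 1 then c1 else if n = 2 then c2 else if n = 3 then c3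
    else if n = 4 then c4 else if n = 5 then c5 else if n = 6 then c6 else 0 := by
  simp only [q6, ← Polynomial.C_eq_intCast, coeff_add, coeff_C, coeff_C_mul, coeff_X_pow, coeff_X]
  rcases n with _|_|_|_|_|_|_|n <;> simp
  

lemma q6_dvd (k c0 c1 c2 c3 c4 c5 c6 : ℤ) : (k : ℤ[X]) ∣ q6 c0 c1 c2 c3 c4 c5 c6 ↔
    k ∣ c0 ∧ k ∣ c1 ∧ k ∣ c2 ∧ k ∣ c3 ∧ k ∣ c4 ∧ k ∣ c5 ∧ k ∣ c6 := by
  rw [← Polynomial.C_eq_intCast, Polynomial.C_dvd_iff_dvd_coeff]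
  constructor
  · intro h
    refine ⟨?_,?_,?_,?_,?_,?_,?_⟩
    · simpa [q6_coeff] using h 0
    · simpa [q6_coeff] using h 1
    · simpa [q6_coeff] using h 2
    · simpa [q6_coeff] using h 3
    · simpa [q6_coeff] using h 4
    · simpa [q6_coeff] using h 5
    · simpa [q6_coeff] using h 6
  · rintro ⟨h0,h1,h2,h3,h4,h5,h6⟩ i
    rw [q6_coeff]
    split_ifs <;> first | assumption | exact dvd_zero _

lemma q6_zero {c0 c1 c2 c3 c4 c5 c6 : ℤ} (h : q6 c0 c1 c2 c3 c4 c5 c6 = 0) :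
    c0 = 0 ∧ c1 = 0 ∧ c2 = 0 ∧ c3 = 0 ∧ c4 = 0 ∧ c5 = 0 ∧ c6 = 0 := by
  have := (q6_dvd 0 c0 c1 c2 c3 c4 c5 c6).1 (by rw [h]; exact dvd_zero _)
  simpa only [zero_dvd_iff] using this

/-- degree bound -/
def dg (n : ℕ) (f : ℤ[X]) : Prop := f.natDegree ≤ n

lemma dg.add {n f g} (hf : dg n f) (hg : dg n g) : dg n (f + g) := natDegree_add_le_of_degree_le hf hg
lemma dg.sub {n f g} (hf : dg n f) (hg : dg n g) : dg n (f - g) := natDegree_sub_le_of_le hf hg |>.trans (by simp)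
lemma dg.neg {n f} (hf : dg n f) : dg n (- f) := by unfold dg at *; simpa using hf
lemma dg.mul {m n k f g} (hf : dg m f) (hg : dg n g) (h : m + n ≤ k) : dg k (f * g) :=
  (natDegree_mul_le_of_le hf hg).trans h
lemma dg.sq {m k f} (hf : dg m f) (h : m + m ≤ k) : dg k (f^2) := by
  rw [_root_.sq]; exact hf.mul hf h
lemma dg.mono {m k f} (hf : dg m f) (h : m ≤ k) : dg k f := le_trans hf h
lemma dg_int (k : ℕ) (n : ℤ) : dg k (n : ℤ[X]) := by unfold dg; simp
lemma dg_X {k : ℕ} (h : 1 ≤ k): dg k (X : ℤ[X]) := by unfold dg; simpa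
lemma dg.pow {m k f} (hf : dg m f) (n : ℕ) (h : n * m ≤ k) : dg k (f^n) :=
  (natDegree_pow_le_of_le n hf).trans h
lemma dg.of_mul {k : ℕ} {n : ℤ} {f : ℤ[X]} (h : dg k ((n:ℤ[X]) * f)) (hn : n ≠ 0) : dg k f := by
  unfold dg at *
  rwa [← Polynomial.C_eq_intCast, Int.cast_id, natDegree_C_mul hn] at h

lemma dg.out {f : ℤ[X]} (h : dg 6 f) : f = q6 (f.coeff 0) (f.coeff 1) (f.coeff 2) (f.coeff 3)
    (f.coeff 4) (f.coeff 5) (f.coeff 6) := by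
  ext n
  rw [q6_coeff]
  split_ifs with h0 h1 h2 h3 h4 h5 h6
  all_goals first | (subst_vars; rfl) | skip
  exact coeff_eq_zero_of_natDegree_lt (lt_of_le_of_lt h (by omega))

lemma dg.z {k n : ℕ} {f : ℤ[X]} (h : dg k f) (hn : k < n) : f.coeff n = 0 :=
  coeff_eq_zero_of_natDegree_lt (lt_of_le_of_lt h hn)

lemma dg1 {f : ℤ[X]} (h : dg 1 f) : ∃ a b : ℤ, f = a + b * (X:ℤ[X]) := by
  have := (h.mono (by norm_num : 1 ≤ 6)).out
  simp only [h.z (show 1 < 2 by norm_num), h.z (show 1 < 3 by norm_num), h.z (show 1 < 4 by norm_num), h.z (show 1 < 5 by norm_num), h.z (show 1 < 6 by norm_num)] at this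
  exact ⟨f.coeff 0, f.coeff 1, this.trans (by simp [q6])⟩
lemma dg2 {f : ℤ[X]} (h : dg 2 f) : ∃ a b c : ℤ, f = a + b * (X:ℤ[X]) + c * (X:ℤ[X])^2 := by
  have := (h.mono (by norm_num : 2 ≤ 6)).out
  simp only [h.z (show 2 < 3 by norm_num), h.z (show 2 < 4 by norm_num), h.z (show 2 < 5 by norm_num), h.z (show 2 < 6 by norm_num)] at this
  exact ⟨f.coeff 0, f.coeff 1, f.coeff 2, this.trans (by simp [q6])⟩
lemma dg3 {f : ℤ[X]} (h : dg 3 f) : ∃ a b c d : ℤ, f = a + b * (X:ℤ[X]) + c * (X:ℤ[X])^2 + d * (X:ℤ[X])^3 := by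
  have := (h.mono (by norm_num : 3 ≤ 6)).out
  simp only [h.z (show 3 < 4 by norm_num), h.z (show 3 < 5 by norm_num), h.z (show 3 < 6 by norm_num)] at this
  exact ⟨f.coeff 0, f.coeff 1, f.coeff 2, f.coeff 3, this.trans (by simp [q6])⟩
lemma dg4 {f : ℤ[X]} (h : dg 4 f) : ∃ a b c d e : ℤ, f = a + b * (X:ℤ[X]) + c * (X:ℤ[X])^2 + d * (X:ℤ[X])^3 + e * (X:ℤ[X])^4 := by
  have := (h.mono (by norm_num : 4 ≤ 6)).out
  simp only [h.z (show 4 < 5 by norm_num), h.z (show 4 < 6 by norm_num)] at this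
  exact ⟨f.coeff 0, f.coeff 1, f.coeff 2, f.coeff 3, f.coeff 4, this.trans (by simp [q6])⟩
lemma dg1' (a b : ℤ) : dg 1 ((a:ℤ[X]) + b * (X:ℤ[X])) :=
  (dg_int 1 a).add ((dg_int 0 b).mul (dg_X le_rfl) le_rfl)
lemma dg2' (a b c : ℤ) : dg 2 ((a:ℤ[X]) + b * (X:ℤ[X]) + c * (X:ℤ[X])^2) :=
  ((dg1' a b).mono (by norm_num)).add ((dg_int 0 c).mul ((dg_X le_rfl).pow 2 le_rfl) (by norm_num))
lemma dg3' (a b c d : ℤ) : dg 3 ((a:ℤ[X]) + b * (X:ℤ[X]) + c * (X:ℤ[X])^2 + d * (X:ℤ[X])^3) :=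
  ((dg2' a b c).mono (by norm_num)).add ((dg_int 0 d).mul ((dg_X le_rfl).pow 3 le_rfl) (by norm_num))
lemma dg4' (a b c d e : ℤ) : dg 4 ((a:ℤ[X]) + b * (X:ℤ[X]) + c * (X:ℤ[X])^2 + d * (X:ℤ[X])^3 + e * (X:ℤ[X])^4) :=
  ((dg3' a b c d).mono (by norm_num)).add ((dg_int 0 e).mul ((dg_X le_rfl).pow 4 le_rfl) (by norm_num))

lemma prime_int {p : ℤ} (hp : Prime p) : Prime (p : ℤ[X]) := by
  rw [← Polynomial.C_eq_intCast]; exact Polynomial.prime_C_iff.2 hp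
lemma prime_two' : Prime (2 : ℤ[X]) := by
  exact_mod_cast prime_int Int.prime_two

lemma dg.of_two {k i: ℕ} {f : ℤ[X]} (h : dg k ((2:ℤ[X])^i * f)) : dg k f := by
  have : dg k (((2^i:ℤ):ℤ[X]) * f) := by push_cast; exact h
  exact this.of_mul (by positivity)

noncomputable def GG : ℤ[X] := X - 2 * (X:ℤ[X])^3 + 2 * (X:ℤ[X])^4 - X^5
lemma dg_GG : dg 6 GG := by
  have : GG = q6 0 1 0 (-2) 2 (-1) 0 := by unfold GG q6; push_cast; ring
  rw [this, dg, natDegree_le_iff_coeff_eq_zero]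
  intro n hn; rw [q6_coeff]; repeat rw [if_neg (by omega)]

structure Wk (A T C : ℤ[X]) (N : ℤ) : Prop where
  hA : dg 2 A
  hT : dg 3 T
  hC : dg 4 C
  eq : A * C = T^2 + (X:ℤ[X])^3 * T * (N:ℤ[X]) - GG * (N:ℤ[X])^2
  notin : ∀ l, dg 1 l → ¬ (2:ℤ[X]) ∣ T - A * l

theorem mod2bits : ∀ a0 a1 a2 c0 c1 c2 c3 c4 : ZMod 2, a0*c1+a1*c0 = 0 → a0*c3+a1*c2+a2*c1=0 → a1*c4+a2*c3=0 →
   (∀ l0 l1 : ZMod 2, ¬ (a0*c0-a0*l0=0 ∧ a0*c2+a1*c1+a2*c0-a0*l1-a1*l0 = 0 ∧ a0*c4+a1*c3+a2*c2-a1*l1-a2*l0=0 ∧ a2*c4-a2*l1=0)) →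
    a1 = 0 ∧ c1 = 0 ∧ c3 = 0 ∧ c0*a2+c2*a0*a2+c4*a0 = 1 := by decide

lemma zm (n : ℤ) : (n : ZMod 2) = 0 ↔ (2:ℤ) ∣ n := by
  exact_mod_cast ZMod.intCast_zmod_eq_zero_iff_dvd n 2

lemma zm1 (n : ℤ) : (n : ZMod 2) = 1 ↔ ¬ (2:ℤ) ∣ n := by
  rw [← zm]
  generalize (n:ZMod 2) = m
  revert m; decide

lemma zsq (n : ZMod 2) : n^2 = n := by revert n; decide

lemma two_cast : ((2:ℤ):ℤ[X]) = 2 := by norm_num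

theorem mod2 {a0 a1 a2 t0 t1 t2 t3 c0 c1 c2 c3 c4 : ℤ} {A T C : ℤ[X]}
   (hA : A = a0 + a1 * (X:ℤ[X]) + a2 * (X:ℤ[X])^2)
   (hT : T = t0 + t1 * (X:ℤ[X]) + t2 * (X:ℤ[X])^2 + t3 * (X:ℤ[X])^3)
   (hC : C = c0 + c1 * (X:ℤ[X]) + c2 * (X:ℤ[X])^2 + c3 * (X:ℤ[X])^3 + c4 * (X:ℤ[X])^4)
   (h : (2:ℤ[X]) ∣ A * C - T^2) (hn : ∀ l, dg 1 l → ¬ (2:ℤ[X]) ∣ T - A * l) :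
   2 ∣ a1 ∧ 2 ∣ c1 ∧ 2 ∣ c3 ∧ 2 ∣ t0 - a0*c0 ∧ 2 ∣ t1 - (a0*c2+a2*c0) ∧ 2 ∣ t2 - (a0*c4+a2*c2) ∧
   2 ∣ t3 - a2*c4 ∧ ¬ 2 ∣ c0*a2+c2*a0*a2+c4*a0 := by
  have h1 : A * C - T^2 = q6 (a0*c0-t0^2) (a0*c1+a1*c0-2*t0*t1) (a0*c2+a1*c1+a2*c0-2*t0*t2-t1^2)
    (a0*c3+a1*c2+a2*c1-2*t0*t3-2*t1*t2) (a0*c4+a1*c3+a2*c2-2*t1*t3-t2^2) (a1*c4+a2*c3-2*t2*t3)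
    (a2*c4-t3^2) := by
    subst hA hT hC; unfold q6; push_cast; ring
  rw [h1, ← two_cast, q6_dvd] at h
  obtain ⟨e0,e1,e2,e3,e4,e5,e6⟩ := h
  rw [← zm] at e0 e1 e2 e3 e4 e5 e6
  have h2 : (2:ZMod 2) = 0 := by decide
  push_cast at e0 e1 e2 e3 e4 e5 e6
  simp only [zsq, h2, zero_mul, sub_zero, sub_eq_zero] at e0 e1 e2 e3 e4 e5 e6
  have hb : ∀ l0 l1 : ZMod 2, ¬ ((a0:ZMod 2)*c0-a0*l0=0 ∧ (a0:ZMod 2)*c2+a1*c1+a2*c0-a0*l1-a1*l0 = 0 ∧ (a0:ZMod 2)*c4+a1*c3+a2*c2-a1*l1-a2*l0=0 ∧ (a2:ZMod 2)*c4-a2*l1=0) := by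
    intro l0 l1 
    obtain ⟨l0, rfl⟩ := ZMod.intCast_surjective l0
    obtain ⟨l1, rfl⟩ := ZMod.intCast_surjective l1
    rintro ⟨f0,f1,f2,f3⟩
    apply hn _ (dg1' l0 l1)
    have : T - A * (l0 + l1 * (X:ℤ[X])) = q6 (t0-a0*l0) (t1-a0*l1-a1*l0) (t2-a1*l1-a2*l0) (t3-a2*l1) 0 0 0 := by
      subst hA hT; unfold q6; push_cast; ring
    rw [this, ← two_cast, q6_dvd]
    simp only [← zm]
    push_cast
    rw [← e0, ← e2, ← e4, ← e6]
    exact ⟨f0,f1,f2,f3,rfl,rfl,rfl⟩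
  obtain ⟨r1,r2,r3,r4⟩ := mod2bits _ _ _ _ _ _ _ _ e1 e3 e5 hb
  have r4' : (c0*a2+c2*a0*a2+c4*a0 : ℤ) = (1:ZMod 2) := by push_cast; exact r4
  rw [zm1] at r4'
  simp only [← zm] at r4' ⊢
  push_cast
  rw [← e0, ← e2, ← e4, ← e6, r1, r2, r3]
  refine ⟨rfl, rfl, rfl, ?_, ?_, ?_, ?_, ?_⟩
  · ring
  · ring
  · ring
  · ring
  · rw [r4]; decide

lemma Wk.coeffs {a0 a1 a2 t0 t1 t2 t3 c0 c1 c2 c3 c4 N : ℤ} {A T C : ℤ[X]}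
   (h : Wk A T C N) (hA : A = a0 + a1 * (X:ℤ[X]) + a2 * (X:ℤ[X])^2)
   (hT : T = t0 + t1 * (X:ℤ[X]) + t2 * (X:ℤ[X])^2 + t3 * (X:ℤ[X])^3)
   (hC : C = c0 + c1 * (X:ℤ[X]) + c2 * (X:ℤ[X])^2 + c3 * (X:ℤ[X])^3 + c4 * (X:ℤ[X])^4) :
   a0*c0=t0^2 ∧ a0*c1+a1*c0=2*t0*t1-N^2 ∧ a0*c2+a1*c1+a2*c0=2*t0*t2+t1^2 ∧ 
   a0*c3+a1*c2+a2*c1=2*t0*t3+2*t1*t2+t0*N+2*N^2 ∧ a0*c4+a1*c3+a2*c2=2*t1*t3+t2^2+t1*N-2*N^2 ∧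
   a1*c4+a2*c3=2*t2*t3+t2*N+N^2 ∧ a2*c4=t3^2+t3*N := by
  have h0 := h.eq
  have h1 : q6 (a0*c0-t0^2) (a0*c1+a1*c0-(2*t0*t1-N^2)) (a0*c2+a1*c1+a2*c0-(2*t0*t2+t1^2))
   (a0*c3+a1*c2+a2*c1-(2*t0*t3+2*t1*t2+t0*N+2*N^2)) (a0*c4+a1*c3+a2*c2-(2*t1*t3+t2^2+t1*N-2*N^2))
   (a1*c4+a2*c3-(2*t2*t3+t2*N+N^2)) (a2*c4-(t3^2+t3*N)) = 0 := by
    subst hA hT hC; unfold q6; unfold GG at h0; push_cast; linear_combination h0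
  obtain ⟨e0,e1,e2,e3,e4,e5,e6⟩ := q6_zero h1
  refine ⟨?_,?_,?_,?_,?_,?_,?_⟩ <;> linarith

lemma Wk.two {A T C : ℤ[X]} {N : ℤ} (h : Wk A T C N) (hN : 2 ∣ N) : (2:ℤ[X]) ∣ A * C - T^2 := by
  obtain ⟨m, rfl⟩ := hN
  refine ⟨X^3*T*(m:ℤ[X]) - 2*GG*(m:ℤ[X])^2, ?_⟩
  rw [h.eq]; push_cast; ring

open Polynomial

lemma bitsE : ∀ a0 a2 e0 e1 e2 e3 : ZMod 2, a0*e1+a2*e0=0 → a0*e3+a2*e2=0 →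
   ¬ (a0*e0)*a2+(a0*e2+a2*e1)*a0*a2+(a2*e3)*a0 = 1 := by decide

lemma pdvd {f g : ℤ[X]} {l : ℕ} (hf : ¬ (2:ℤ[X]) ∣ f) (h : (2:ℤ[X])^l ∣ f * g) : (2:ℤ[X])^l ∣ g :=
  prime_two'.pow_dvd_of_dvd_mul_left l hf h

theorem mod2' {A T C : ℤ[X]} (hA : dg 2 A) (hT : dg 3 T) (hC : dg 4 C)
   (h : (2:ℤ[X]) ∣ A * C - T^2) (hn : ∀ l, dg 1 l → ¬ (2:ℤ[X]) ∣ T - A * l) :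
   ∃ l w : ℤ[X], dg 1 l ∧ dg 2 w ∧ (2:ℤ[X]) ∣ A - l^2 ∧ (2:ℤ[X]) ∣ T - l*w ∧ (2:ℤ[X]) ∣ C - w^2 ∧ ¬ (2:ℤ[X]) ∣ l ∧
    ∀ E, dg 3 E → ¬ (2:ℤ[X]) ∣ w^2 - l*E := by
  obtain ⟨a0,a1,a2,hA⟩ := dg2 hA
  obtain ⟨t0,t1,t2,t3,hT⟩ := dg3 hT
  obtain ⟨c0,c1,c2,c3,c4,hC⟩ := dg4 hC
  obtain ⟨h1,h2,h3,h4,h5,h6,h7,h8⟩ := mod2 hA hT hC h hn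
  have sqd : ∀ a : ℤ, 2 ∣ a - a^2 := by
    intro a
    rcases Int.even_or_odd' a with ⟨b, rfl | rfl⟩
    · exact ⟨b-2*b^2, by ring⟩
    · exact ⟨-b-2*b^2, by ring⟩
  refine ⟨a0+a2*(X:ℤ[X]), c0+c2*(X:ℤ[X])+c4*(X:ℤ[X])^2, dg1' _ _, dg2' _ _ _, ?_, ?_, ?_, ?_, ?_⟩
  · have : A - (a0+a2*(X:ℤ[X]))^2 = q6 (a0-a0^2) (a1-2*a0*a2) (a2-a2^2) 0 0 0 0 := by
      subst hA; unfold q6; push_cast; ring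
    rw [this, ← two_cast, q6_dvd]
    refine ⟨sqd _, dvd_sub h1 ⟨a0*a2, by ring⟩, sqd _, dvd_zero _, dvd_zero _, dvd_zero _, dvd_zero _⟩
  · have : T - (a0+a2*(X:ℤ[X]))*(c0+c2*(X:ℤ[X])+c4*(X:ℤ[X])^2) = q6 (t0-a0*c0) (t1-(a0*c2+a2*c0)) (t2-(a0*c4+a2*c2)) (t3-a2*c4) 0 0 0 := by
      subst hT; unfold q6; push_cast; ring
    rw [this, ← two_cast, q6_dvd]
    exact ⟨h4,h5,h6,h7, dvd_zero _, dvd_zero _, dvd_zero _⟩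
  · have : C - (c0+c2*(X:ℤ[X])+c4*(X:ℤ[X])^2)^2 = q6 (c0-c0^2) (c1-2*c0*c2) (c2-c2^2-2*c0*c4) (c3-2*c2*c4) (c4-c4^2) 0 0 := by
      subst hC; unfold q6; push_cast; ring
    rw [this, ← two_cast, q6_dvd]
    refine ⟨sqd _, dvd_sub h2 ⟨c0*c2, by ring⟩, dvd_sub (sqd _) ⟨c0*c4, by ring⟩, dvd_sub h3 ⟨c2*c4, by ring⟩, sqd _, dvd_zero _, dvd_zero _⟩
  · intro hd
    have : (a0+a2*(X:ℤ[X])) = q6 a0 a2 0 0 0 0 0 := by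
      unfold q6; push_cast; ring
    rw [this, ← two_cast, q6_dvd] at hd
    obtain ⟨⟨x, rfl⟩, ⟨y, rfl⟩, -⟩ := hd
    exact h8 ⟨c0*y+2*c2*x*y+c4*x, by ring⟩
  · intro E hE hd
    obtain ⟨e0,e1,e2,e3,rfl⟩ := dg3 hE
    have : (c0+c2*(X:ℤ[X])+c4*(X:ℤ[X])^2)^2 - (a0+a2*(X:ℤ[X]))*(e0+e1*(X:ℤ[X])+e2*(X:ℤ[X])^2+e3*(X:ℤ[X])^3) =
       q6 (c0^2-a0*e0) (2*c0*c2-(a0*e1+a2*e0)) (c2^2+2*c0*c4-(a0*e2+a2*e1)) (2*c2*c4-(a0*e3+a2*e2)) (c4^2-a2*e3) 0 0 := by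
      unfold q6; push_cast; ring
    rw [this, ← two_cast, q6_dvd] at hd
    obtain ⟨e0,e1,e2,e3,e4,-⟩ := hd
    rw [← zm] at e0 e1 e2 e3 e4
    have h2 : (2:ZMod 2) = 0 := by decide
    push_cast at e0 e1 e2 e3 e4
    simp only [zsq, h2, zero_mul, add_zero, zero_sub, neg_eq_zero, sub_eq_zero] at e0 e1 e2 e3 e4
    have := bitsE _ _ _ _ _ _ e1 e3
    rw [← zm1] at h8
    push_cast at h8
    rw [e0, e2, e4] at h8
    exact this h8

set_option synthInstance.maxHeartbeats 400000 in
set_option synthInstance.maxSize 1000 in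
lemma bits1 : ∀ a b c d0 d1 d2 : ZMod 2, a*d0=0 → a*d1+b*d0=0 → a*d2+b*d1+c*d0=0 → (a=1∨b=1) →
   (b*d2+c*d1=1 ∨ c*d2 = 1) → b*d2+c*d1=1 ∧ d0=0 ∧ d1=0 ∧ d2=1 := by decide

lemma bits2 : ∀ s t u v : ZMod 2, s*v+t*u=0 → (s*u=1∨t*v=1) → u=s*u ∧ v=t*v := by decide

lemma caseW {A T A' lam l R A1 W : ℤ[X]} {v0 m v1 : ℤ} {i0 j : ℕ} (hj : 1 ≤ j) (hv : v0 = 2^i0*m) (hm : ¬ 2 ∣ m)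
   (hv1 : ¬ 2 ∣ v1)
   (hA' : dg 2 A') (hlam : dg 1 lam) (hl : dg 1 l) (hR : dg 3 R) (hA1 : dg 2 A1) (hW : dg 4 W)
   (h2A : ¬ (2:ℤ[X]) ∣ A) (h2l : ¬ (2:ℤ[X]) ∣ l)
   (e1 : lam * A - v0 * T = l * A' + 2^(i0+j)*R) (e2 : A = l^2 + 2^(i0+j)*A1)
   (e3 : A' * A1 = 2*l*R - (X:ℤ[X])^3*l*v1+2^(i0+j)*W)
   (e4 : A' * W = R^2 - (X:ℤ[X])^3*R*v1 - GG*v1^2)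
   (notin : ∀ l, dg 1 l → ¬ (2:ℤ[X]) ∣ T - A * l) : False := by
  obtain ⟨a,b,c,rfl⟩ := dg2 hA'
  obtain ⟨d0,d1,d2,rfl⟩ := dg2 hA1
  obtain ⟨al,be,rfl⟩ := dg1 hl
  obtain ⟨r0,r1,r2,r3,rfl⟩ := dg3 hR
  obtain ⟨w0,w1,w2,w3,w4,rfl⟩ := dg4 hW
  set w := i0 + j with hw
  have hw1 : 1 ≤ w := by omega
  have q4 : q6 (a*w0-r0^2) (a*w1+b*w0-(2*r0*r1-v1^2)) (a*w2+b*w1+c*w0-(r1^2+2*r0*r2)) (a*w3+b*w2+c*w1-(2*r0*r3+2*r1*r2-r0*v1+2*v1^2)) (a*w4+b*w3+c*w2-(2*r1*r3+r2^2-r1*v1-2*v1^2)) (b*w4+c*w3-(2*r2*r3-r2*v1+v1^2)) (c*w4-(r3^2-r3*v1)) = 0 := by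
    unfold q6; unfold GG at e4; push_cast; linear_combination e4
  obtain ⟨-,f1,-⟩ := q6_zero q4
  have hab : ¬ 2 ∣ a ∨ ¬ 2 ∣ b := by
    by_contra hc
    push Not at hc
    obtain ⟨⟨a', rfl⟩, ⟨b', rfl⟩⟩ := hc
    apply hv1
    apply Int.prime_two.dvd_of_dvd_pow (n := 2)
    exact ⟨r0*r1-a'*w1-b'*w0, by linarith⟩
  have q3 : q6 (a*d0 - (2*al*r0+2^w*w0)) (a*d1+b*d0-(2*(al*r1+be*r0)+2^w*w1)) (a*d2+b*d1+c*d0-(2*(al*r2+be*r1)+2^w*w2))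
     (b*d2+c*d1-(2*(al*r3+be*r2)-al*v1+2^w*w3)) (c*d2-(2*be*r3-be*v1+2^w*w4)) 0 0 = 0 := by
    unfold q6; push_cast; linear_combination e3
  obtain ⟨g0,g1,g2,g3,g4,-,-⟩ := q6_zero q3
  have hal : ¬ (2 ∣ al ∧ 2 ∣ be) := by
    rintro ⟨⟨x,rfl⟩,⟨y,rfl⟩⟩
    exact h2l ⟨x+y*(X:ℤ[X]), by push_cast; ring⟩
  obtain ⟨w', hw'⟩ : ∃ w', w = w'+1 := ⟨w-1, by omega⟩
  have h20 : (2:ZMod 2) = 0 := by decide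
  have z1 : (v1:ZMod 2) = 1 := (zm1 _).2 hv1
  have neg1 : ∀ t : ZMod 2, -t = t := by decide
  have z0 := congrArg (Int.cast : ℤ → ZMod 2) g0
  have zz1 := congrArg (Int.cast : ℤ → ZMod 2) g1
  have zz2 := congrArg (Int.cast : ℤ → ZMod 2) g2
  have zz3 := congrArg (Int.cast : ℤ → ZMod 2) g3
  have zz4 := congrArg (Int.cast : ℤ → ZMod 2) g4
  rw [hw'] at z0 zz1 zz2 zz3 zz4
  push_cast at z0 zz1 zz2 zz3 zz4
  simp only [h20, pow_succ, mul_zero, zero_mul, add_zero, zero_add, sub_zero, z1, mul_one, zero_sub, neg1, sub_eq_zero] at z0 zz1 zz2 zz3 zz4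
  obtain ⟨k1,k2,k3,k4⟩ := bits1 _ _ _ _ _ _ z0 zz1 zz2 (by rw [zm1,zm1]; exact hab) (by
    rw [zz3, zz4, zm1, zm1]; tauto)
  rw [zz3, zm1] at k1
  rw [zm] at k2 k3
  rw [zm1] at k4
  have hpt : (a*be^2-b*al*be+c*al^2)*(d0*be^2-d1*al*be+d2*al^2) = 2^w*(w0*be^4-w1*be^3*al+w2*be^2*al^2-w3*be*al^3+w4*al^4) := by
    linear_combination be^4*g0 - be^3*al*g1+be^2*al^2*g2-be*al^3*g3+al^4*g4
  have hodd : ¬ 2 ∣ (d0*be^2-d1*al*be+d2*al^2) := by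
    intro hd
    have : 2 ∣ d2*al^2 := by
      have h1 : (2:ℤ) ∣ d0*be^2-d1*al*be := dvd_sub (k2.mul_right _) ((k3.mul_right _).mul_right _)
      exact (dvd_add_right h1).1 hd
    rcases Int.prime_two.dvd_or_dvd this with h | h
    · exact k4 h
    · exact k1 (Int.prime_two.dvd_of_dvd_pow h)
  obtain ⟨pt, hpt'⟩ : (2:ℤ)^w ∣ (a*be^2-b*al*be+c*al^2) := 
    Int.prime_two.pow_dvd_of_dvd_mul_right w hodd ⟨_, hpt⟩
  have hpt'' := congrArg (Int.cast : ℤ → ℤ[X]) hpt'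
  push_cast at hpt''
  set mu : ℤ[X] := ((al*a:ℤ):ℤ[X]) + ((al*b-a*be:ℤ):ℤ[X])*(X:ℤ[X]) with hmu
  have hm1 : (al:ℤ[X])^2*(a+b*(X:ℤ[X])+c*(X:ℤ[X])^2) = mu * (al + be*(X:ℤ[X])) + 2^w*pt*(X:ℤ[X])^2 := by
    rw [hmu]; push_cast
    linear_combination (X:ℤ[X])^2*hpt''
  have hv0 : (v0:ℤ[X]) = 2^i0*m := by rw [hv]; push_cast; ring
  have hbig : ((al:ℤ[X])^2*lam - mu)*A = 2^i0*((al:ℤ[X])^2*m*T + 2^j*((al:ℤ[X])^2*(r0 + r1 * (X:ℤ[X]) + r2 * (X:ℤ[X]) ^ 2 + r3 * (X:ℤ[X]) ^ 3)-mu*(d0+d1*(X:ℤ[X])+d2*(X:ℤ[X])^2)+(al+be*(X:ℤ[X]))*pt*(X:ℤ[X])^2)) := by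
    rw [hw, pow_add] at e1 e2 hm1
    rw [hv0] at e1
    linear_combination (al:ℤ[X])^2*e1 + (al+be*(X:ℤ[X]))*hm1 - mu*e2
  obtain ⟨nu, hnu⟩ := pdvd h2A (g := (al:ℤ[X])^2*lam - mu) (l := i0) (by rw [mul_comm, hbig]; exact dvd_mul_right _ _)
  have hnud : dg 1 nu := by
    apply dg.of_two (i := i0)
    rw [← hnu]
    refine dg.sub (dg.mul (m := 0) ?_ hlam le_rfl) (dg1' _ _)
    exact (dg_int 0 al).pow 2 le_rfl
  apply notin nu hnud
  rw [hnu] at hbig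
  have hbig2 := mul_left_cancel₀ (pow_ne_zero i0 prime_two'.ne_zero) ((mul_assoc _ _ _).symm.trans hbig)
  have hom : ¬ 2 ∣ al^2*m := by
    intro h
    rcases Int.prime_two.dvd_or_dvd h with h | h
    · exact k1 (Int.prime_two.dvd_of_dvd_pow h)
    · exact hm h
  obtain ⟨k, hk⟩ : ∃ k, al^2*m = 2*k+1 := ⟨al^2*m/2, by omega⟩
  have hk' := congrArg (Int.cast : ℤ → ℤ[X]) hk
  push_cast at hk'
  obtain ⟨j', rfl⟩ : ∃ j', j = j'+1 := ⟨j-1, by omega⟩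
  refine ⟨-(k*T) - 2^j'*((al:ℤ[X])^2*(r0 + r1 * (X:ℤ[X]) + r2 * (X:ℤ[X]) ^ 2 + r3 * (X:ℤ[X]) ^ 3)-mu*(d0+d1*(X:ℤ[X])+d2*(X:ℤ[X])^2)+(al+be*(X:ℤ[X]))*pt*(X:ℤ[X])^2), ?_⟩
  rw [pow_succ] at hbig2
  linear_combination -hbig2 - T*hk'

lemma caseI {A T A' lam l R A1 W : ℤ[X]} {v2 V1 : ℤ} {k : ℕ}
   (hA' : dg 2 A') (hA : dg 2 A) (hlam : dg 1 lam) (hl : dg 1 l) (hR : dg 3 R) (hA1 : dg 2 A1) (hW : dg 4 W)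
   (h2A' : ¬ (2:ℤ[X]) ∣ A') (h2l : ¬ (2:ℤ[X]) ∣ l)
   (e1 : lam * A - 2^(k+1)*v2 * T = l * A' + 2^(k+1)*R) (e2 : A = l^2 + 2^(k+1)*A1)
   (e3 : A' * A1 = 2*l*R - (X:ℤ[X])^3*l*(2*V1)+2^(k+1)*W)
   (e4 : A' * W = R^2 - (X:ℤ[X])^3*R*(2*V1) - GG*(2*V1)^2)
   (notin : ∀ l, dg 1 l → ¬ (2:ℤ[X]) ∣ R - A' * l) : False := by
  have two0 : (2:ℤ[X]) ≠ 0 := prime_two'.ne_zero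
  obtain ⟨A2, rfl⟩ : (2:ℤ[X]) ∣ A1 := by
    have := pdvd (l := 1) h2A' (g := A1) ⟨l*R - (X:ℤ[X])^3*l*V1+2^k*W, by rw [e3]; ring⟩
    simpa using this
  have e3' : A' * A2 = l*R - (X:ℤ[X])^3*l*V1+2^k*W := by
    apply mul_left_cancel₀ two0
    linear_combination e3
  have hA2 : dg 2 A2 := dg.of_two (i := 1) (by simpa using hA1)
  have e5 : l*(A' - lam*l) = 2^(k+1)*(2*lam*A2-v2*T-R) := by
    rw [e2] at e1
    linear_combination -e1
  obtain ⟨B, hB⟩ := pdvd h2l (g := A' - lam*l) (l := k+1) (by rw [e5]; exact dvd_mul_right _ _)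
  have hBd : dg 2 B := by
    apply dg.of_two (i := k+1); rw [← hB]; exact hA'.sub (hlam.mul hl le_rfl)
  have e6 : l*(R-(X:ℤ[X])^3*V1-lam*A2) = 2^k*(2*B*A2-W) := by
    linear_combination A2*hB - e3'
  obtain ⟨E, hE⟩ := pdvd h2l (g := R-(X:ℤ[X])^3*V1-lam*A2) (l := k) (by rw [e6]; exact dvd_mul_right _ _)
  have hEd : dg 3 E := by
    apply dg.of_two (i := k); rw [← hE]
    refine (hR.sub ?_).sub (hlam.mul hA2 le_rfl)
    exact ((dg_X le_rfl).pow 3 le_rfl).mul (dg_int 0 V1) le_rfl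
  have e7 : l*E = 2*B*A2-W := by
    apply mul_left_cancel₀ (pow_ne_zero k two0)
    rw [hE] at e6
    linear_combination e6
  obtain ⟨l', w', hl', hw', m1, m2, m3, m4, m5⟩ := mod2' hA' hR hW
    ⟨-(X:ℤ[X])^3*R*V1 - 2*GG*V1^2, by linear_combination e4⟩ notin
  have hll : (2:ℤ[X]) ∣ l' - l := by
    have m6 : (2:ℤ[X]) ∣ l'^2 - lam*l := by
      have : l'^2 - lam*l = -(A'-l'^2) + 2*(2^k*B) := by linear_combination hB
      rw [this]; exact dvd_add (dvd_neg.2 m1) (dvd_mul_right _ _)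
    obtain ⟨p,q,rfl⟩ := dg1 hl'
    obtain ⟨s,t,rfl⟩ := dg1 hlam
    obtain ⟨u,v,rfl⟩ := dg1 hl
    have q1 : (p + q*(X:ℤ[X]))^2 - (s+t*(X:ℤ[X]))*(u+v*(X:ℤ[X])) = q6 (p^2-s*u) (2*p*q-(s*v+t*u)) (q^2-t*v) 0 0 0 0 := by
      unfold q6; push_cast; ring
    rw [q1, ← two_cast, q6_dvd] at m6
    obtain ⟨z0,z1,z2,-⟩ := m6
    rw [← zm] at z0 z1 z2
    have h20 : (2:ZMod 2) = 0 := by decide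
    push_cast at z0 z1 z2
    simp only [zsq, h20, zero_mul, zero_sub, neg_eq_zero, sub_eq_zero] at z0 z1 z2
    have q2 : (p + q*(X:ℤ[X])) = q6 p q 0 0 0 0 0 := by unfold q6; push_cast; ring
    have q3 : (p + q*(X:ℤ[X])) - (u+v*(X:ℤ[X])) = q6 (p-u) (q-v) 0 0 0 0 0 := by unfold q6; push_cast; ring
    rw [q2, ← two_cast, q6_dvd] at m4
    have hor : (s:ZMod 2)*u=1 ∨ (t:ZMod 2)*v=1 := by
      rw [← z0, ← z2, zm1, zm1]
      by_contra hc; push Not at hc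
      exact m4 ⟨hc.1, hc.2, dvd_zero _, dvd_zero _, dvd_zero _, dvd_zero _, dvd_zero _⟩
    obtain ⟨y1,y2⟩ := bits2 _ _ _ _ z1 hor
    rw [q3, ← two_cast, q6_dvd, ← zm, ← zm]
    push_cast
    refine ⟨by rw [z0, ← y1, sub_self], by rw [z2, ← y2, sub_self], by simp⟩
  apply m5 (-E) hEd.neg
  have : w'^2 - l' * -E = -(W - w'^2) + 2*(B*A2) + (l'-l)*E := by linear_combination e7
  rw [this]
  exact dvd_add (dvd_add (dvd_neg.2 m3) (dvd_mul_right _ _)) (hll.mul_right _)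

theorem step2 {A T C A' lam : ℤ[X]} {N v0 m n : ℤ} {i0 j : ℕ} (hw : Wk A T C N) (hN : N = 2^j*n)
   (hn : ¬ 2 ∣ n) (hj : 1 ≤ j) (hA' : dg 2 A') (hlam : dg 1 lam) (hv : v0 = 2^i0*m) (hm : ¬ 2 ∣ m)
   (Q : A'^2 = A*lam^2 - v0*lam*(2*T+(X:ℤ[X])^3*N)+v0^2*C) (h2A' : ¬ (2:ℤ[X]) ∣ A') :
   ∃ (A1 T1 C1 : ℤ[X]) (j' : ℕ) (n' : ℤ), 1 ≤ j' ∧ j' < j ∧ ¬ 2 ∣ n' ∧ Wk A1 T1 C1 (2^j'*n') := by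
  have two0 : (2:ℤ[X]) ≠ 0 := prime_two'.ne_zero
  have h2N : 2 ∣ N := by rw [hN]; exact (dvd_pow_self 2 (by omega)).mul_right _
  obtain ⟨l0, w0, hl0, hw0, m1, m2, m3, m4, -⟩ := mod2' hw.hA hw.hT hw.hC (hw.two h2N) hw.notin
  have h2A : ¬ (2:ℤ[X]) ∣ A := by
    intro h
    apply m4
    apply prime_two'.dvd_of_dvd_pow (n := 2)
    exact (dvd_sub_right h).1 m1
  obtain ⟨N1, hN1⟩ := h2N
  have hN1' : (N:ℤ[X]) = 2*N1 := by rw [hN1]; push_cast; ring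
  have d1 : (2:ℤ[X]) ∣ A' - (l0*lam+v0*w0) := by
    apply prime_two'.dvd_of_dvd_pow (n := 2)
    have : (A' - (l0*lam+v0*w0))^2 = (A-l0^2)*lam^2+v0^2*(C-w0^2)+2*(-v0*lam*(T+(X:ℤ[X])^3*N1)-A'*(l0*lam+v0*w0)+l0^2*lam^2+l0*lam*v0*w0+v0^2*w0^2) := by
      rw [hN1'] at Q
      linear_combination Q
    rw [this]
    exact dvd_add (dvd_add (m1.mul_right _) (m3.mul_left _)) (dvd_mul_right _ _)
  set U := lam*A-v0*T with hU
  have hUd : dg 3 U := (hlam.mul hw.hA le_rfl).sub ((dg_int 0 v0).mul hw.hT le_rfl)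
  have eU : A*A'^2 = U^2 - (X:ℤ[X])^3*U*(v0*N) - GG*(v0*N)^2 := by
    rw [hU]
    linear_combination A*Q + v0^2*hw.eq
  let P : ℕ → Prop := fun i => ∃ l R : ℤ[X], dg 1 l ∧ U = l*A' + 2^i*R
  have hP1 : P 1 := by
    have : (2:ℤ[X]) ∣ U - l0*A' := by
      have e : U - l0*A' = lam*(A-l0^2) - v0*(T-l0*w0) - l0*(A'-(l0*lam+v0*w0)) + 2*(-l0*v0*w0) := by
        rw [hU]; ring
      rw [e]
      exact dvd_add (dvd_sub (dvd_sub (m1.mul_left _) (m2.mul_left _)) (d1.mul_left _)) (dvd_mul_right _ _)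
    obtain ⟨R, hR⟩ := this
    exact ⟨l0, R, hl0, by linear_combination hR⟩
  obtain ⟨i, hi1, hiw, ⟨l, R, hl, hUl⟩, hmax⟩ : ∃ i, 1 ≤ i ∧ i ≤ i0+j ∧ P i ∧ (i < i0+j → ¬ P (i+1)) := by
    classical
    refine ⟨Nat.findGreatest P (i0+j), Nat.le_findGreatest (by omega) hP1, Nat.findGreatest_le _, Nat.findGreatest_spec (m := 1) (by omega) hP1, ?_⟩
    intro h
    exact Nat.findGreatest_is_greatest (Nat.lt_succ_self _) h
  obtain ⟨e, he⟩ : ∃ e, i0 + j = i + e := ⟨i0+j-i, by omega⟩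
  have hV : (v0:ℤ[X])*N = 2^i*(2^e*(m*n)) := by
    rw [hv, hN]; push_cast
    have : (2:ℤ[X])^i0*2^j = 2^i*2^e := by rw [← pow_add, ← pow_add, he]
    linear_combination (m:ℤ[X])*n*this
  have hmn : ¬ 2 ∣ m*n := by
    intro h; rcases Int.prime_two.dvd_or_dvd h with h | h
    · exact hm h
    · exact hn h
  set V : ℤ := 2^e*(m*n) with hVd
  have hV' : (v0:ℤ[X])*N = 2^i*V := by rw [hV, hVd]; push_cast; ring
  have hRd : dg 3 R := by
    apply dg.of_two (i := i)
    have : 2^i*R = U - l*A' := by linear_combination -hUl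
    rw [this]; exact hUd.sub (hl.mul hA' le_rfl)
  have b1 : A'*(A*A'-l^2*A'-2*2^i*l*R+(X:ℤ[X])^3*l*(2^i*V)) = (2^i)^2*(R^2-(X:ℤ[X])^3*R*V-GG*V^2) := by
    rw [hV', hUl] at eU
    linear_combination eU
  obtain ⟨W, hW⟩ := pdvd h2A' (l := i*2) (by rw [b1, pow_mul]; exact dvd_mul_right _ _)
  have p0 : ((2:ℤ[X])^i)≠0 := pow_ne_zero _ two0
  have b2 : A'*W = R^2-(X:ℤ[X])^3*R*V-GG*V^2 := by
    apply mul_left_cancel₀ (pow_ne_zero 2 p0)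
    rw [hW, pow_mul] at b1
    linear_combination b1
  have b3 : A'*(A-l^2) = 2^i*(2*l*R-(X:ℤ[X])^3*l*V+2^i*W) := by
    rw [pow_mul] at hW
    linear_combination hW
  obtain ⟨A1, hA1⟩ := pdvd h2A' (g := A - l^2) (l := i) (by rw [b3]; exact dvd_mul_right _ _)
  have b4 : A'*A1 = 2*l*R-(X:ℤ[X])^3*l*V+2^i*W := by
    apply mul_left_cancel₀ p0
    rw [hA1] at b3
    linear_combination b3
  have hA1d : dg 2 A1 := by
    apply dg.of_two (i := i); rw [← hA1]; exact hw.hA.sub (hl.sq le_rfl)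
  have hX3 : dg 3 ((X:ℤ[X])^3) := (dg_X le_rfl).pow 3 le_rfl
  have hWd : dg 4 W := by
    apply dg.of_two (i := i)
    have : 2^i*W = A'*A1 - ((2:ℤ):ℤ[X])*(l*R)+(X:ℤ[X])^3*(l*V) := by push_cast; linear_combination -b4
    rw [this]
    exact ((hA'.mul hA1d le_rfl).sub ((dg_int 0 2).mul (hl.mul hRd le_rfl) le_rfl)).add (hX3.mul (hl.mul (dg_int 0 V) le_rfl) le_rfl)
  have e2 : A = l^2 + 2^i*A1 := by linear_combination hA1
  have h2l : ¬ (2:ℤ[X]) ∣ l := by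
    intro h
    apply h2A
    rw [e2]
    exact dvd_add (h.trans (dvd_pow_self _ (by norm_num))) ((dvd_pow_self _ (by omega)).mul_right _)
  rcases eq_or_lt_of_le hiw with hiw' | hiw'
  · exfalso
    have he0 : e = 0 := by omega
    have hVm : V = m*n := by rw [hVd, he0]; ring
    rw [hVm] at b4 b2
    subst hiw'
    exact caseW hj hv hm hmn hA' hlam hl hRd hA1d hWd h2A h2l (hU.symm.trans hUl) e2 (by exact_mod_cast b4) (by exact_mod_cast b2) hw.notin
  · have hnR : ∀ l', dg 1 l' → ¬ (2:ℤ[X]) ∣ R - A' * l' := by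
      rintro l' hl' ⟨R', hR'⟩
      apply hmax hiw'
      refine ⟨l + (2^i:ℤ)*l', R', hl.add ((dg_int 0 _).mul hl' le_rfl), ?_⟩
      rw [hUl, pow_succ]; push_cast
      linear_combination 2^i*hR'
    obtain ⟨e', rfl⟩ : ∃ e', e = e'+1 := ⟨e-1, by omega⟩
    rcases le_or_gt i i0 with hii | hii
    · exfalso
      obtain ⟨k, rfl⟩ : ∃ k, i = k+1 := ⟨i-1, by omega⟩
      obtain ⟨f, rfl⟩ : ∃ f, i0 = k+1+f := ⟨i0-(k+1), by omega⟩
      have hVV : (V:ℤ[X]) = 2*((2^e'*(m*n):ℤ):ℤ[X]) := by rw [hVd]; push_cast; ring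
      have hvv : (v0:ℤ[X]) = 2^(k+1)*((2^f*m:ℤ):ℤ[X]) := by rw [hv]; push_cast; ring
      rw [hVV] at b4 b2
      rw [hvv] at hU
      exact caseI hA' hw.hA hlam hl hRd hA1d hWd h2A' h2l (hU.symm.trans hUl) e2 b4 b2 hnR
    · refine ⟨A', -R, W, e'+1, m*n, by omega, by omega, hmn, hA', hRd.neg, hWd, ?_, ?_⟩
      · rw [b2]; ring
      · intro l' hl' hd
        apply hnR (-l') hl'.neg
        have : R - A' * -l' = -(-R - A'*l') := by ring
        rw [this]; exact dvd_neg.2 hd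

open Polynomial

lemma odd_mul' {a b : ℤ} (ha : ¬ 2 ∣ a) (hb : ¬ 2 ∣ b) : ¬ 2 ∣ a*b := by
  intro h; rcases Int.prime_two.dvd_or_dvd h with h | h
  · exact ha h
  · exact hb h

lemma two_pow_split {a : ℤ} (ha : a ≠ 0) : ∃ (j : ℕ) (n : ℤ), a = 2^j*n ∧ ¬ 2 ∣ n := by
  have hf : FiniteMultiplicity (2:ℤ) a := by
    rw [Int.finiteMultiplicity_iff]; exact ⟨by norm_num, ha⟩
  obtain ⟨n, hn, hn'⟩ := hf.exists_eq_pow_mul_and_not_dvd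
  exact ⟨_, n, hn, hn'⟩

lemma init_even {r p Y y : ℤ} {a : ℕ} (hp : 2 ∣ p) (hr : ¬ 2 ∣ r) (h : Y^2+p^3*Y = r^5*p-2*r^3*p^3+2*r^2*p^4-r*p^5)
   (hY : Y = 2^a*y) (hy : ¬ 2 ∣ y) : 1 ≤ a ∧ (2:ℤ)^(a+2) ∣ p^3 ∧ ∃ (A T C : ℤ[X]) (n : ℤ), ¬ 2 ∣ n ∧ Wk A T C (2^a*n) := by
  set g := r^5-2*r^3*p^2+2*r^2*p^3-r*p^4 with hg
  have hgo : ¬ 2 ∣ g := by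
    intro hd
    have : 2 ∣ r^5 := by
      have h2 : r^5 = g + p*(2*r^3*p-2*r^2*p^2+r*p^3) := by rw [hg]; ring
      rw [h2]; exact dvd_add hd (hp.mul_right _)
    exact hr (Int.prime_two.dvd_of_dvd_pow this)
  have hE : Y*(Y+p^3) = p*g := by rw [hg]; linear_combination h
  have ha : 1 ≤ a := by
    by_contra hc
    have : a = 0 := by omega
    subst this
    rw [pow_zero, one_mul] at hY
    subst hY
    have h1 : 2 ∣ Y*(Y+p^3) := by rw [hE]; exact hp.mul_right _
    refine odd_mul' hy ?_ h1
    intro h2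
    exact hy ((dvd_add_left (hp.trans (dvd_pow_self _ (by norm_num)))).1 h2)
  have hap : (2:ℤ)^a ∣ p := by
    apply Int.prime_two.pow_dvd_of_dvd_mul_right a hgo
    rw [← hE, hY, mul_assoc]; exact dvd_mul_right _ _
  have hp3 : (2:ℤ)^(a+2) ∣ p^3 := by
    have : p^3 = p*(p*p) := by ring
    rw [this, pow_add]
    exact mul_dvd_mul hap (mul_dvd_mul hp hp)
  refine ⟨ha, hp3, ?_⟩
  obtain ⟨k, hk⟩ := hp3
  refine ⟨((0:ℤ):ℤ[X])+p*(X:ℤ[X])+((-r:ℤ):ℤ[X])*(X:ℤ[X])^2, ((0:ℤ):ℤ[X])+g*(X:ℤ[X])+((0:ℤ):ℤ[X])*(X:ℤ[X])^2+((0:ℤ):ℤ[X])*(X:ℤ[X])^3, 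
    ((g*(-r^4)+(Y+p^3)*r^2*(-r^2*p^2):ℤ):ℤ[X]) + ((g*(-2*r^3*p+2*r^2*p^2-r*p^3)+(Y+p^3)*r^2*(-r^3*p):ℤ):ℤ[X])*(X:ℤ[X]) + ((g*(2*r^3*p-r^2*p^2)+(Y+p^3)*r^2*(2*r^2*p^2-r^4):ℤ):ℤ[X])*(X:ℤ[X])^2 + ((g*(-r^3*p)+(Y+p^3)*r^2*(-r*p^3):ℤ):ℤ[X])*(X:ℤ[X])^3 +((0:ℤ):ℤ[X])*(X:ℤ[X])^4,
    r^2*(y+4*k), ?_, dg2' _ _ _, dg3' _ _ _ _, dg4' _ _ _ _ _, ?_, ?_⟩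
  · apply odd_mul'
    · intro h; exact hr (Int.prime_two.dvd_of_dvd_pow h)
    · omega
  · have hN : (2^a*(r^2*(y+4*k)) : ℤ) = r^2*(Y+p^3) := by rw [hk, hY]; ring
    rw [hN]
    have hE' := congrArg (Int.cast : ℤ → ℤ[X]) hE
    have hg' := congrArg (Int.cast : ℤ → ℤ[X]) hg
    push_cast at hE' hg' ⊢
    unfold GG
    generalize (g:ℤ[X]) = g at *
    rw [hg'] at hE' ⊢
    linear_combination (r:ℤ[X])^4*((X:ℤ[X]) - 2 * X^3 + 2 * X^4 - X^5)*hE'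
  · intro l hl hd
    obtain ⟨l0,l1,rfl⟩ := dg1 hl
    have : (((0:ℤ):ℤ[X])+g*(X:ℤ[X])+((0:ℤ):ℤ[X])*(X:ℤ[X])^2+((0:ℤ):ℤ[X])*(X:ℤ[X])^3) - (((0:ℤ):ℤ[X])+p*(X:ℤ[X])+((-r:ℤ):ℤ[X])*(X:ℤ[X])^2) * (l0+l1*(X:ℤ[X])) = q6 0 (g-p*l0) (r*l0-p*l1) (r*l1) 0 0 0 := by
      unfold q6; push_cast; ring
    rw [this, ← two_cast, q6_dvd] at hd
    apply hgo
    exact (dvd_sub_left (hp.mul_right l0)).1 hd.2.1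

lemma y0_ex {Y p : ℤ} (hp : ¬ 2 ∣ p) : ∃ y0 : ℤ, y0^2+y0=0 ∧ ¬ 2 ∣ Y-y0*p^3 := by
  by_cases h : 2 ∣ Y
  · refine ⟨-1, by norm_num, ?_⟩
    intro hd
    have : 2 ∣ p^3 := by
      have e : p^3 = (Y - -1*p^3) - Y := by ring
      rw [e]; exact dvd_sub hd h
    exact hp (Int.prime_two.dvd_of_dvd_pow this)
  · exact ⟨0, by norm_num, by simpa using h⟩

lemma init_re {r p Y : ℤ} (hp : ¬ 2 ∣ p) (hr : 2 ∣ r) (hr0 : r ≠ 0) (h : Y^2+p^3*Y = r^5*p-2*r^3*p^3+2*r^2*p^4-r*p^5) :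
   ∃ (A T C : ℤ[X]) (j : ℕ) (n : ℤ), 1 ≤ j ∧ ¬ 2 ∣ n ∧ Wk A T C (2^j*n) := by
  obtain ⟨y0, hy0, hD⟩ := y0_ex (Y := Y) hp
  set D := Y - y0*p^3 with hDd
  have hDD : D^2+(2*y0+1)*p^3*D = r*(r^4*p-2*r^2*p^3+2*r*p^4-p^5) := by
    rw [hDd]; linear_combination h - p^6*hy0
  obtain ⟨j, n, hjn, hn⟩ := two_pow_split hr0
  refine ⟨(p:ℤ[X])+((-r:ℤ):ℤ[X])*(X:ℤ[X])+((0:ℤ):ℤ[X])*(X:ℤ[X])^2, ((0:ℤ):ℤ[X])+((0:ℤ):ℤ[X])*(X:ℤ[X])+D*(X:ℤ[X])^2+((r*p^2*y0:ℤ):ℤ[X])*(X:ℤ[X])^3, 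
     ((0:ℤ):ℤ[X])+((r*(-r*p^3):ℤ):ℤ[X])*(X:ℤ[X])+((r*(-r^2*p^2):ℤ):ℤ[X])*(X:ℤ[X])^2+((r*(2*r*p^3-r^3*p):ℤ):ℤ[X])*(X:ℤ[X])^3+((r*(-p^4)-(2*y0+1)*p^2*D:ℤ):ℤ[X])*(X:ℤ[X])^4,
     j, n*p^2, ?_, odd_mul' hn ?_, dg2' _ _ _, dg3' _ _ _ _, dg4' _ _ _ _ _, ?_, ?_⟩
  · by_contra hc
    have : j = 0 := by omega
    subst this
    rw [pow_zero, one_mul] at hjn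
    exact hn (hjn ▸ hr)
  · intro h; exact hp (Int.prime_two.dvd_of_dvd_pow h)
  · have hN : (2^j*(n*p^2) : ℤ) = r*p^2 := by rw [hjn]; ring
    rw [hN]
    have hE' := congrArg (Int.cast : ℤ → ℤ[X]) hDD
    have hg' := congrArg (Int.cast : ℤ → ℤ[X]) hy0
    push_cast at hE' hg' ⊢
    unfold GG
    linear_combination -(X:ℤ[X])^4*hE' - X^6*(r:ℤ[X])^2*p^4*hg'
  · intro l hl hd
    obtain ⟨l0,l1,rfl⟩ := dg1 hl
    have : (((0:ℤ):ℤ[X])+((0:ℤ):ℤ[X])*(X:ℤ[X])+D*(X:ℤ[X])^2+((r*p^2*y0:ℤ):ℤ[X])*(X:ℤ[X])^3) - ((p:ℤ[X])+((-r:ℤ):ℤ[X])*(X:ℤ[X])+((0:ℤ):ℤ[X])*(X:ℤ[X])^2) * (l0+l1*(X:ℤ[X])) = q6 (-p*l0) (r*l0-p*l1) (D+r*l1) (r*p^2*y0) 0 0 0 := by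
      unfold q6; push_cast; ring
    rw [this, ← two_cast, q6_dvd] at hd
    apply hD
    exact (dvd_add_left (hr.mul_right l1)).1 hd.2.2.1

lemma init_oo {r p Y : ℤ} (hp : ¬ 2 ∣ p) (hr : ¬ 2 ∣ r) (hrp : r ≠ p) (h : Y^2+p^3*Y = r^5*p-2*r^3*p^3+2*r^2*p^4-r*p^5) :
   ∃ (A T C : ℤ[X]) (j : ℕ) (n : ℤ), 1 ≤ j ∧ ¬ 2 ∣ n ∧ Wk A T C (2^j*n) := by
  obtain ⟨y0, hy0, hD⟩ := y0_ex (Y := Y) hp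
  set D := Y - y0*p^3 with hDd
  set s := r - p with hs
  set k := r^3+r^2*p-r*p^2+p^3 with hk
  have hs2 : 2 ∣ s := by omega
  have hDD : D^2+(2*y0+1)*p^3*D = s*(r*p*k) := by
    rw [hDd, hs, hk]; linear_combination h - p^6*hy0
  obtain ⟨j, n, hjn, hn⟩ := two_pow_split (sub_ne_zero.2 hrp)
  rw [← hs] at hjn
  refine ⟨(p:ℤ[X])+((-(r+p):ℤ):ℤ[X])*(X:ℤ[X])+(r:ℤ[X])*(X:ℤ[X])^2, ((0:ℤ):ℤ[X])+((0:ℤ):ℤ[X])*(X:ℤ[X])+D*(X:ℤ[X])^2+((s*p^2*y0-D:ℤ):ℤ[X])*(X:ℤ[X])^3, 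
     ((0:ℤ):ℤ[X])+((s*(-s*p^3):ℤ):ℤ[X])*(X:ℤ[X])+((s*(-s*p^3-r*s*p^2):ℤ):ℤ[X])*(X:ℤ[X])^2+((s*(s*p^3-r*s*p^2-r^2*s*p):ℤ):ℤ[X])*(X:ℤ[X])^3+((s*(p*k)-(2*y0+1)*p^2*D:ℤ):ℤ[X])*(X:ℤ[X])^4,
     j, n*p^2, ?_, odd_mul' hn ?_, dg2' _ _ _, dg3' _ _ _ _, dg4' _ _ _ _ _, ?_, ?_⟩
  · by_contra hc
    have : j = 0 := by omega
    subst this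
    rw [pow_zero, one_mul] at hjn
    exact hn (hjn ▸ hs2)
  · intro h; exact hp (Int.prime_two.dvd_of_dvd_pow h)
  · have hN : (2^j*(n*p^2) : ℤ) = s*p^2 := by rw [hjn]; ring
    rw [hN]
    have hE' := congrArg (Int.cast : ℤ → ℤ[X]) hDD
    have hg' := congrArg (Int.cast : ℤ → ℤ[X]) hy0
    have hs' := congrArg (Int.cast : ℤ → ℤ[X]) hs
    have hk' := congrArg (Int.cast : ℤ → ℤ[X]) hk
    push_cast at hE' hg' hs' hk' ⊢
    unfold GG
    generalize (s:ℤ[X]) = s at *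
    generalize (k:ℤ[X]) = k at *
    subst hs' hk'
    linear_combination -(X:ℤ[X])^4*(1-X)^2*hE' - X^6*((r:ℤ[X])-p)^2*p^4*hg'
  · intro l hl hd
    obtain ⟨l0,l1,rfl⟩ := dg1 hl
    have : (((0:ℤ):ℤ[X])+((0:ℤ):ℤ[X])*(X:ℤ[X])+D*(X:ℤ[X])^2+((s*p^2*y0-D:ℤ):ℤ[X])*(X:ℤ[X])^3) - ((p:ℤ[X])+((-(r+p):ℤ):ℤ[X])*(X:ℤ[X])+(r:ℤ[X])*(X:ℤ[X])^2) * (l0+l1*(X:ℤ[X])) = q6 (-p*l0) ((r+p)*l0-p*l1) (D+(r+p)*l1-r*l0) (s*p^2*y0-D-r*l1) 0 0 0 := by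
      unfold q6; push_cast; ring
    rw [this, ← two_cast, q6_dvd] at hd
    obtain ⟨h0, -, h2, -⟩ := hd
    have hl0 : 2 ∣ l0 := by
      rcases Int.prime_two.dvd_or_dvd h0 with h | h
      · exact absurd (by simpa using h) hp
      · exact h
    have hrp2 : 2 ∣ r + p := by omega
    apply hD
    have e : D = (D+(r+p)*l1-r*l0) - (r+p)*l1+r*l0 := by ring
    rw [e]
    exact dvd_add (dvd_sub h2 (hrp2.mul_right _)) (hl0.mul_left _)

theorem vzero {A T C A' lam : ℤ[X]} {n : ℤ} {j : ℕ} (hw : Wk A T C (2^j*n))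
   (hn : ¬ 2 ∣ n) (hj : 1 ≤ j) (hlam0 : lam ≠ 0) 
   (hprim : ∀ q : ℤ, Prime q → ¬ (q:ℤ[X]) ∣ A)
   (Q : A'^2 = A*lam^2) :
   ∃ (A1 T1 C1 : ℤ[X]) (j' : ℕ) (n' : ℤ), 1 ≤ j' ∧ j' < j ∧ ¬ 2 ∣ n' ∧ Wk A1 T1 C1 (2^j'*n') := by
  set N := 2^j*n with hN
  have hN0 : N ≠ 0 := by
    rw [hN]; refine mul_ne_zero (by positivity) ?_
    rintro rfl; simp at hn
  have h2N : 2 ∣ N := by rw [hN]; exact (dvd_pow_self 2 (by omega)).mul_right _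
  obtain ⟨L, hL⟩ : lam ∣ A' := by
    rw [← IsIntegrallyClosed.pow_dvd_pow_iff (n := 2) (by norm_num)]
    exact ⟨A, by rw [Q]; ring⟩
  have hAL : A = L^2 := by
    apply mul_right_cancel₀ (pow_ne_zero 2 hlam0)
    rw [← Q, hL]; ring
  have hLd : dg 1 L := by
    have := hw.hA
    unfold dg at *
    rw [hAL, natDegree_pow] at this
    omega
  obtain ⟨p, r', hLe⟩ := dg1 hLd
  obtain ⟨r, rfl⟩ : ∃ r, r' = -r := ⟨-r', by ring⟩
  have hcop : IsCoprime r p := by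
    rw [Int.isCoprime_iff_gcd_eq_one]
    by_contra hc
    obtain ⟨q, hq, hqd⟩ := Nat.exists_prime_and_dvd hc
    have h1 : (q:ℤ) ∣ r := (Int.natCast_dvd_natCast.2 hqd).trans (Int.gcd_dvd_left ..)
    have h2 : (q:ℤ) ∣ p := (Int.natCast_dvd_natCast.2 hqd).trans (Int.gcd_dvd_right ..)
    apply hprim q (Nat.prime_iff_prime_int.1 hq)
    rw [hAL, hLe]
    obtain ⟨a, rfl⟩ := h1
    obtain ⟨b, rfl⟩ := h2
    exact ⟨q*(b-a*(X:ℤ[X]))^2, by push_cast; ring⟩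
  obtain ⟨t0,t1,t2,t3,hT⟩ := dg3 hw.hT
  obtain ⟨c0,c1,c2,c3,c4,hC⟩ := dg4 hw.hC
  have hA : A = ((p^2:ℤ):ℤ[X]) + ((-2*r*p:ℤ):ℤ[X])*(X:ℤ[X])+((r^2:ℤ):ℤ[X])*(X:ℤ[X])^2 := by
    rw [hAL, hLe]; push_cast; ring
  obtain ⟨e0,e1,e2,e3,e4,e5,e6⟩ := hw.coeffs hA hT hC
  obtain ⟨-,-,-,-,-,-,-,m8⟩ := mod2 hA hT hC (hw.two h2N) hw.notin
  set τ := t0*r^3+t1*r^2*p+t2*r*p^2+t3*p^3 with hτ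
  have f1 : τ^2+p^3*τ*N-(r^5*p-2*r^3*p^3+2*r^2*p^4-r*p^5)*N^2 = 0 := by
    rw [hτ]
    linear_combination -(r^6*e0+r^5*p*e1+r^4*p^2*e2+r^3*p^3*e3+r^2*p^4*e4+r*p^5*e5+p^6*e6)
  obtain ⟨M, hM⟩ : N ∣ 2*τ+p^3*N := by
    rw [← Int.pow_dvd_pow_iff (n := 2) (by norm_num)]
    exact ⟨p^6+4*(r^5*p-2*r^3*p^3+2*r^2*p^4-r*p^5), by linear_combination 4*f1⟩
  have f2 : M^2 = p^6+4*(r^5*p-2*r^3*p^3+2*r^2*p^4-r*p^5) := by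
    apply mul_left_cancel₀ (pow_ne_zero 2 hN0)
    linear_combination 4*f1 - (2*τ+p^3*N+N*M)*hM
  obtain ⟨Y, hY⟩ : 2 ∣ M - p^3 := by
    have h1 : 2 ∣ (M-p^3)^2 := ⟨p^6+2*(r^5*p-2*r^3*p^3+2*r^2*p^4-r*p^5)-M*p^3, by linear_combination f2⟩
    exact Int.prime_two.dvd_of_dvd_pow h1
  have hM2 : M = 2*Y+p^3 := by linarith
  subst hM2
  have hYeq : Y^2+p^3*Y = r^5*p-2*r^3*p^3+2*r^2*p^4-r*p^5 := by linarith [f2, (by ring : (2*Y+p^3)^2 = 4*(Y^2+p^3*Y)+p^6)]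
  have hτY : τ = N*Y := by linarith [hM, (by ring : N*(2*Y+p^3) = 2*(N*Y)+p^3*N)]
  have hTx : (2*Y+p^3)*(3*t0*r^2+2*t1*r*p+t2*p^2) = (5*r^4*p-6*r^2*p^3+4*r*p^4-p^5)*N := by
    apply mul_left_cancel₀ hN0
    have hM' : 2*τ+p^3*N = N*(2*Y+p^3) := hM
    rw [hτ] at hM'
    linear_combination -(3*t0*r^2+2*t1*r*p+t2*p^2)*hM' - (6*r^5*e0+5*r^4*p*e1+4*r^3*p^2*e2+3*r^2*p^3*e3+2*r*p^4*e4+p^5*e5)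
  by_cases hp : 2 ∣ p
  · have hr : ¬ 2 ∣ r := by
      intro hr
      obtain ⟨u, v, huv⟩ := hcop
      have : (2:ℤ) ∣ 1 := by rw [← huv]; exact dvd_add (hr.mul_left _) (hp.mul_left _)
      omega
    have hp0 : p ≠ 0 := by
      rintro rfl
      have h0 : t0 = 0 := by
        have : t0^2 = 0 := by linarith
        exact pow_eq_zero_iff (by norm_num) |>.1 this
      have : N^2 = 0 := by rw [h0] at e1; linarith
      exact hN0 (pow_eq_zero_iff (by norm_num) |>.1 this)
    have hg : ¬ 2 ∣ r^5-2*r^3*p^2+2*r^2*p^3-r*p^4 := by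
      intro hd
      have : 2 ∣ r^5 := by
        have h2 : r^5 = (r^5-2*r^3*p^2+2*r^2*p^3-r*p^4) + p*(2*r^3*p-2*r^2*p^2+r*p^3) := by ring
        rw [h2]; exact dvd_add hd (hp.mul_right _)
      exact hr (Int.prime_two.dvd_of_dvd_pow this)
    have hY0 : Y ≠ 0 := by
      rintro rfl
      have h1 : p*(r^5-2*r^3*p^2+2*r^2*p^3-r*p^4) = 0 := by linear_combination -hYeq
      rcases mul_eq_zero.1 h1 with h | h
      · exact hp0 h
      · rw [h] at hg; simp at hg
    obtain ⟨a, y, hay, hy⟩ := two_pow_split hY0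
    obtain ⟨ha, hp3, A1, T1, C1, n1, hn1, hW1⟩ := init_even hp hr hYeq hay hy
    refine ⟨A1, T1, C1, a, n1, ha, ?_, hn1, hW1⟩
    have hc0 : ¬ 2 ∣ c0 := by
      intro h
      apply m8
      have e : c0*r^2+c2*p^2*r^2+c4*p^2 = c0*r^2 + p*(p*(c2*r^2+c4)) := by ring
      rw [e]
      exact dvd_add (h.mul_right _) (hp.mul_right _)
    obtain ⟨s, hs⟩ : p ∣ t0 := by
      rw [← Int.pow_dvd_pow_iff (n := 2) (by norm_num)]
      exact ⟨c0, e0.symm⟩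
    have hso : ¬ 2 ∣ s := by
      intro h
      apply hc0
      have : c0 = s^2 := by
        apply mul_left_cancel₀ (pow_ne_zero 2 hp0)
        rw [e0, hs]; ring
      rw [this]; exact h.trans (dvd_pow_self _ (by norm_num))
    obtain ⟨k, hk⟩ := hp3
    obtain ⟨p2, hp2⟩ := hp
    have g1 : 2^(a+1)*(y+2*k)*(3*s*r^2+2*t1*r+t2*p) = (5*r^4-6*r^2*p^2+4*r*p^3-p^4)*N := by
      apply mul_left_cancel₀ hp0
      have e : 2^(a+1)*(y+2*k) = 2*Y+p^3 := by rw [hay, hk]; ring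
      rw [e]
      rw [hs] at hTx
      linear_combination hTx
    by_contra hc
    have hc' : j ≤ a := by omega
    obtain ⟨b, rfl⟩ : ∃ b, a = j + b := ⟨a - j, by omega⟩
    have g2 : 2*(2^b*(y+2*k)*(3*s*r^2+2*t1*r+t2*p)) = (5*r^4-6*r^2*p^2+4*r*p^3-p^4)*n := by
      apply mul_left_cancel₀ (pow_ne_zero j (two_ne_zero (α := ℤ)))
      rw [hN] at g1
      rw [pow_succ, pow_add] at g1
      linear_combination g1
    have g3 : ¬ 2 ∣ 5*r^4-6*r^2*p^2+4*r*p^3-p^4 := by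
      intro h
      have e : r^4 = (5*r^4-6*r^2*p^2+4*r*p^3-p^4) + 2*(-2*r^4+3*r^2*p^2-2*r*p^3+p2*p^3) := by
        rw [hp2]; ring
      have : 2 ∣ r^4 := by rw [e]; exact dvd_add h (dvd_mul_right _ _)
      exact hr (Int.prime_two.dvd_of_dvd_pow this)
    exact odd_mul' g3 hn ⟨_, g2.symm⟩
  · exfalso
    have hp3 : ¬ 2 ∣ 2*Y+p^3 := by
      intro h
      exact hp (Int.prime_two.dvd_of_dvd_pow ((dvd_add_right (dvd_mul_right _ _)).1 h))
    have hx : 2 ∣ 3*t0*r^2+2*t1*r*p+t2*p^2 := by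
      have : 2 ∣ (2*Y+p^3)*(3*t0*r^2+2*t1*r*p+t2*p^2) := by rw [hTx]; exact h2N.mul_left _
      exact (Int.prime_two.dvd_or_dvd this).resolve_left hp3
    have hz : 2 ∣ t1*r^2+2*t2*r*p+3*t3*p^2 := by
      have : 2 ∣ p*(t1*r^2+2*t2*r*p+3*t3*p^2) := by
        have e : p*(t1*r^2+2*t2*r*p+3*t3*p^2) = 3*τ - r*(3*t0*r^2+2*t1*r*p+t2*p^2) := by rw [hτ]; ring
        rw [e, hτY]
        exact dvd_sub ((h2N.mul_right _).mul_left _) (hx.mul_left _)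
      exact (Int.prime_two.dvd_or_dvd this).resolve_left hp
    apply hw.notin _ (dg1' t0 t1)
    have : T - A*(t0+t1*(X:ℤ[X])) = q6 (t0-p^2*t0) (t1-p^2*t1+2*r*p*t0) (t2-r^2*t0+2*r*p*t1) (t3-r^2*t1) 0 0 0 := by
      rw [hT, hA]; unfold q6; push_cast; ring
    rw [this, ← two_cast, q6_dvd]
    rw [← zm] at hx hz
    have z1 := (zm1 _).2 hp
    have h20 : (2:ZMod 2) = 0 := by decide
    have h30 : (3:ZMod 2) = 1 := by decide
    have neg1 : ∀ t : ZMod 2, -t = t := by decide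
    simp only [← zm]
    push_cast at hx hz ⊢
    simp only [h20, h30, z1, zsq, one_mul, mul_one, zero_mul, add_zero, sub_eq_add_neg, neg1] at hx hz ⊢
    have dbl : ∀ t : ZMod 2, t + t = 0 := by decide
    refine ⟨dbl _, dbl _, ?_, ?_, by simp⟩
    · linear_combination hx
    · linear_combination hz

open Polynomial

/-- Normalised state -/
structure Nm (A T C : ℤ[X]) (j : ℕ) (n : ℤ) : Prop where
  wk : Wk A T C (2^j*n)
  odd : ¬ 2 ∣ n
  prim : ∀ q : ℤ, Prime q → ¬ (q:ℤ[X]) ∣ A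
  minn : ∀ q : ℤ, Prime q → ¬ 2 ∣ q → q ∣ n → ∀ l, dg 1 l → ¬ (q:ℤ[X]) ∣ T - A * l

lemma Nm.neg {A T C : ℤ[X]} {j : ℕ} {n : ℤ} (h : Nm A T C j n) : Nm (-A) T (-C) j n := by
  refine ⟨⟨h.wk.hA.neg, h.wk.hT, h.wk.hC.neg, ?_, ?_⟩, h.odd, ?_, ?_⟩
  · rw [neg_mul_neg, h.wk.eq]
  · intro l hl
    have := h.wk.notin (-l) hl.neg
    rwa [mul_neg, ← neg_mul] at this
  · intro q hq; rw [dvd_neg]; exact h.prim q hq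
  · intro q hq hq2 hqn l hl
    have := h.minn q hq hq2 hqn (-l) hl.neg
    rwa [mul_neg, ← neg_mul] at this

lemma Wk.prime2 {A T C : ℤ[X]} {N : ℤ} (h : Wk A T C N) (hN : 2 ∣ N) : ¬ (2:ℤ[X]) ∣ A := by
  intro hd
  have h1 := h.two hN
  have h2 : (2:ℤ[X]) ∣ T^2 := (dvd_sub_right (hd.mul_right _)).1 h1
  have h3 := prime_two'.dvd_of_dvd_pow h2
  exact h.notin 0 (by simpa using dg_int 1 0) (by simpa using h3)

lemma Wk.primitive {A T C : ℤ[X]} {N : ℤ} (h : Wk A T C N) (hN : 2 ∣ N) : 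
    ∃ A' C', Wk A' T C' N ∧ ∀ q : ℤ, Prime q → ¬ (q:ℤ[X]) ∣ A' := by
  have hd := h.prime2 hN
  have hAc := A.eq_C_content_mul_primPart
  set d := A.content with hdd
  have hA' : A = (d:ℤ[X]) * A.primPart := by
    conv_lhs => rw [hAc]
    simp
  have hd2 : ¬ 2 ∣ d := by
    rintro ⟨k, hk⟩
    apply hd
    rw [hA', hk]; push_cast
    exact (dvd_mul_right _ _).mul_right _
  have hd0 : d ≠ 0 := by rintro h; rw [h] at hd2; simp at hd2
  refine ⟨A.primPart, (d:ℤ[X])*C, ⟨?_, h.hT, (dg_int 0 d).mul h.hC le_rfl, ?_, ?_⟩, ?_⟩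
  · exact dg.of_mul (n := d) (by rw [← hA']; exact h.hA) hd0
  · rw [← h.eq]; conv_rhs => rw [hA']
    ring
  · rintro l hl ⟨R, hR⟩
    apply h.notin l hl
    obtain ⟨k, hk⟩ : ∃ k, d = 2*k+1 := ⟨d/2, by omega⟩
    have hk' : (d:ℤ[X]) = 2*k+1 := by rw [hk]; push_cast; ring
    refine ⟨R - k*A.primPart*l, ?_⟩
    rw [hk'] at hA'
    linear_combination hR - l*hA'
  · intro q hq hqd
    have := A.isPrimitive_primPart q (by simpa using hqd)
    exact hq.not_isUnit this

theorem normalizeWk {j : ℕ} (hj : 1 ≤ j) (h : ∃ (A T C : ℤ[X]) (n : ℤ), ¬ 2 ∣ n ∧ Wk A T C (2^j*n)) :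
    ∃ (A T C : ℤ[X]) (n : ℤ), Nm A T C j n := by
  classical
  have hN2 : ∀ n : ℤ, (2:ℤ) ∣ 2^j*n := fun n => (dvd_pow_self 2 (by omega)).mul_right _
  let S : ℕ → Prop := fun k => ∃ (A T C : ℤ[X]) (n : ℤ), ¬ 2 ∣ n ∧ Wk A T C (2^j*n) ∧ n.natAbs = k
  have hS : ∃ k, S k := by
    obtain ⟨A,T,C,n,h1,h2⟩ := h
    exact ⟨_, A,T,C,n,h1,h2,rfl⟩
  obtain ⟨A0, T, C0, n, hn, hw0, hk⟩ := Nat.find_spec hS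
  obtain ⟨A, C, hw, hprim⟩ := hw0.primitive (hN2 n)
  refine ⟨A, T, C, n, hw, hn, hprim, ?_⟩
  rintro q hq hq2 ⟨n1, rfl⟩ l hl ⟨T1, hT1⟩
  have hn0 : n1 ≠ 0 := by rintro rfl; simp at hn
  have hT : T = q*T1+A*l := by linear_combination hT1
  have hlt : n1.natAbs < Nat.find hS := by
    rw [← hk, Int.natAbs_mul]
    have h1 : 1 < q.natAbs := (Int.prime_iff_natAbs_prime.1 hq).one_lt
    have h2 : 0 < n1.natAbs := Int.natAbs_pos.2 hn0
    nlinarith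
  apply Nat.find_min hS hlt
  have hX3 : dg 3 ((X:ℤ[X])^3) := (dg_X le_rfl).pow 3 le_rfl
  have e1 : A*(C-2*T*l+A*l^2-(X:ℤ[X])^3*l*((2^j*(q*n1):ℤ):ℤ[X])) = (q:ℤ[X])^2*(T1^2+(X:ℤ[X])^3*T1*((2^j*n1:ℤ):ℤ[X])-GG*((2^j*n1:ℤ):ℤ[X])^2) := by
    have := hw.eq
    rw [hT] at this ⊢
    push_cast at this ⊢
    linear_combination this
  obtain ⟨C2, hC2⟩ := (prime_int hq).pow_dvd_of_dvd_mul_left 2 (hprim q hq) (by rw [e1]; exact dvd_mul_right _ _)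
  have hq0 : (q:ℤ[X])≠0 := (prime_int hq).ne_zero
  have hq0' : q ≠ 0 := hq.ne_zero
  refine ⟨A, T1, C2, n1, ?_, ⟨hw.hA, ?_, ?_, ?_, ?_⟩, rfl⟩
  · intro h; exact hn (h.mul_left _)
  · apply dg.of_mul (n := q) _ hq0'
    rw [← hT1]; exact hw.hT.sub (hw.hA.mul hl le_rfl)
  · apply dg.of_mul (n := q^2) _ (pow_ne_zero 2 hq0')
    push_cast
    rw [← hC2]
    refine ((hw.hC.sub ?_).add (hw.hA.mul (hl.sq le_rfl) le_rfl)).sub ?_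
    · have := ((dg_int 0 2).mul hw.hT le_rfl).mul hl le_rfl
      simpa using this
    · exact (hX3.mul hl le_rfl).mul (dg_int 0 _) le_rfl
  · apply mul_left_cancel₀ (pow_ne_zero 2 hq0)
    rw [hC2] at e1
    linear_combination e1
  · rintro l' hl' ⟨R, hR⟩
    apply hw.notin (l+q*l') (hl.add ((dg_int 0 q).mul hl' le_rfl))
    exact ⟨q*R, by rw [hT]; linear_combination (q:ℤ[X])*hR⟩

open Polynomial NumberField

noncomputable def zO : OK := -4+4*piK-13*piK^2-18*piK^3-4*piK^4

lemma zO_P : zO^5-4*zO^4+8*zO^3-8*zO^2+4=0 := (zetaP_id piK zO piK_eq rfl).1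

noncomputable def kap : OK := zO^3-4*zO^2+8*zO-8
lemma four_kap : (4:OK) = -(zO^2*kap) := by unfold kap; linear_combination zO_P

lemma zO_pi : zO = piK^2*(-5-6*piK-12*piK^2-10*piK^3-2*piK^4) := by
  unfold zO; linear_combination -(2-2*piK)*piK_eq

lemma eK_unit : IsUnit eK := by
  have h2 : (2:OK) ≠ 0 := two_ne_zero
  have h : piK^5 = 2*(-(1+2*piK^2+5*piK^3+3*piK^4)) := by linear_combination piK_eq
  have : eK * (-(1+2*piK^2+5*piK^3+3*piK^4)) = 1 := by
    apply mul_left_cancel₀ h2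
    have := two_eq'
    rw [h] at this
    linear_combination -this
  exact IsUnit.of_mul_eq_one _ this

/-- linear algebra over a field -/
lemma field_div {F R : Type*} [Field F] [CommRing R] [IsDomain R] (φ : F →+* R)
   {a0 a1 a2 t0 t1 t2 t3 c0 c1 c2 c3 c4 : F} {z : R}
   (e0 : a0*c0=t0^2) (e1 : a0*c1+a1*c0=2*t0*t1) (e2 : a0*c2+a1*c1+a2*c0=2*t0*t2+t1^2)
   (e3 : a0*c3+a1*c2+a2*c1=2*t0*t3+2*t1*t2) (e4 : a0*c4+a1*c3+a2*c2=2*t1*t3+t2^2)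
   (e5 : a1*c4+a2*c3=2*t2*t3) (e6 : a2*c4=t3^2) (hA : ¬ (a0 = 0 ∧ a1 = 0 ∧ a2 = 0))
   (hz : φ a0 + φ a1 * z + φ a2 * z^2 = 0) (hc : φ c0 + φ c1*z+φ c2*z^2+φ c3*z^3+φ c4*z^4=0) :
   ∃ l0 l1 : F, t0=a0*l0 ∧ t1=a0*l1+a1*l0 ∧ t2=a1*l1+a2*l0 ∧ t3=a2*l1 := by
  have hinj := φ.injective
  by_cases h2 : a2 = 0
  · subst h2
    have ht3 : t3 = 0 := by
      apply pow_eq_zero_iff (two_ne_zero) |>.1; rw [← e6]; ring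
    subst ht3
    have h1 : a1 ≠ 0 := by
      rintro rfl
      simp only [map_zero, zero_mul, add_zero] at hz
      exact hA ⟨hinj (by rw [hz, map_zero]), rfl, rfl⟩
    have hc4 : c4 = 0 := by
      apply mul_left_cancel₀ h1; linear_combination e5
    subst hc4
    obtain ⟨l1, hl1⟩ : ∃ l, t2 = a1*l := ⟨t2/a1, by field_simp⟩
    obtain ⟨l0, hl0⟩ : ∃ l, t1 = a0*l1+a1*l := ⟨(t1-a0*l1)/a1, by field_simp; ring⟩
    obtain ⟨ρ, hρ⟩ : ∃ ρ, t0 = a0*l0+ρ := ⟨t0-a0*l0, by ring⟩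
    have hT2 : (φ t0 + φ t1*z+φ t2*z^2)^2 = 0 := by
      have f0 := congrArg φ e0
      have f1 := congrArg φ e1
      have f2 := congrArg φ e2
      have f3 := congrArg φ e3
      have f4 := congrArg φ e4
      simp only [map_mul, map_add, map_pow, map_zero, map_ofNat, mul_zero, zero_mul, add_zero] at f0 f1 f2 f3 f4 hz hc
      linear_combination -(f0+z*f1+z^2*f2+z^3*f3+z^4*f4) + (φ c0 + φ c1*z+φ c2*z^2+φ c3*z^3)*hz
    have hT := pow_eq_zero_iff (two_ne_zero) |>.1 hT2
    have hρ0 : ρ = 0 := by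
      apply hinj
      rw [map_zero]
      rw [hl1, hl0, hρ] at hT
      simp only [map_mul, map_add, map_zero, zero_mul, add_zero] at hT hz
      linear_combination hT - (φ l0+φ l1*z)*hz
    exact ⟨l0, l1, by rw [hρ, hρ0, add_zero], hl0, by rw [hl1]; ring, by ring⟩
  · obtain ⟨l1, rfl⟩ : ∃ l, t3 = a2*l := ⟨t3/a2, by field_simp⟩
    obtain ⟨l0, rfl⟩ : ∃ l, t2 = a1*l1+a2*l := ⟨(t2-a1*l1)/a2, by field_simp; ring⟩
    obtain ⟨ρ0, rfl⟩ : ∃ ρ, t0 = a0*l0+ρ := ⟨t0-a0*l0, by ring⟩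
    obtain ⟨ρ1, rfl⟩ : ∃ ρ, t1 = a0*l1+a1*l0+ρ := ⟨t1-a0*l1-a1*l0, by ring⟩
    obtain ⟨M4, rfl⟩ : ∃ M, c4 = a2*l1^2+M := ⟨c4-a2*l1^2, by ring⟩
    obtain ⟨M3, rfl⟩ : ∃ M, c3 = 2*a2*l0*l1+a1*l1^2+M := ⟨c3-(2*a2*l0*l1+a1*l1^2), by ring⟩
    obtain ⟨M2, rfl⟩ : ∃ M, c2 = a0*l1^2+2*a1*l0*l1+a2*l0^2+2*l1*ρ1+M := ⟨c2-(a0*l1^2+2*a1*l0*l1+a2*l0^2+2*l1*ρ1), by ring⟩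
    obtain ⟨M1, rfl⟩ : ∃ M, c1 = 2*a0*l0*l1+a1*l0^2+2*(l0*ρ1+l1*ρ0)+M := ⟨c1-(2*a0*l0*l1+a1*l0^2+2*(l0*ρ1+l1*ρ0)), by ring⟩
    obtain ⟨M0, rfl⟩ : ∃ M, c0 = a0*l0^2+2*l0*ρ0+M := ⟨c0-(a0*l0^2+2*l0*ρ0), by ring⟩
    have m4 : M4 = 0 := by apply mul_left_cancel₀ h2; linear_combination e6
    subst m4
    have m3 : M3 = 0 := by apply mul_left_cancel₀ h2; linear_combination e5
    subst m3
    have m2 : M2 = 0 := by apply mul_left_cancel₀ h2; linear_combination e4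
    subst m2
    have m1 : M1 = 0 := by apply mul_left_cancel₀ h2; linear_combination e3
    subst m1
    have r1 : ρ1^2 = a2*M0 := by linear_combination -e2
    have r01 : 2*ρ0*ρ1 = a1*M0 := by linear_combination -e1
    have r0 : ρ0^2 = a0*M0 := by linear_combination -e0
    have hr : φ ρ0+φ ρ1*z = 0 := by
      apply pow_eq_zero_iff (two_ne_zero) |>.1
      have f0 := congrArg φ r0
      have f1 := congrArg φ r01
      have f2 := congrArg φ r1
      simp only [map_mul, map_add, map_pow, map_ofNat] at f0 f1 f2
      linear_combination f0 + z*f1+z^2*f2+φ M0*hz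
    have hM : M0 = 0 := by
      apply hinj
      rw [map_zero]
      simp only [map_mul, map_add, map_pow, map_zero, map_ofNat] at hc
      linear_combination hc - (φ l0+φ l1*z)^2*hz - 2*(φ l0+φ l1*z)*hr
    have r1' : ρ1 = 0 := pow_eq_zero_iff (two_ne_zero) |>.1 (by rw [r1, hM, mul_zero])
    have r0' : ρ0 = 0 := pow_eq_zero_iff (two_ne_zero) |>.1 (by rw [r0, hM, mul_zero])
    exact ⟨l0, l1, by rw [r0', add_zero], by rw [r1', add_zero], rfl, rfl⟩

lemma prime_below {R : Type*} [CommRing R] [IsDomain R] {q : R} (hq : Prime q) : ∀ n : ℕ, n ≠ 0 → q ∣ (n:R) → ∃ p : ℕ, p.Prime ∧ p ∣ n ∧ q ∣ (p:R) := by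
  intro n
  induction n using Nat.strong_induction_on with
  | _ n ih =>
  intro hn hd
  by_cases h1 : n = 1
  · subst h1; exact absurd (isUnit_of_dvd_one (by simpa using hd)) hq.not_isUnit
  · have hm := Nat.minFac_prime h1
    obtain ⟨m, hmm⟩ := Nat.minFac_dvd n
    have hm0 : m ≠ 0 := by rintro rfl; simp at hmm; exact hn hmm
    rw [hmm, Nat.cast_mul] at hd
    rcases hq.dvd_or_dvd hd with h | h
    · exact ⟨_, hm, Nat.minFac_dvd n, h⟩
    · have hlt : m < n := by
        have := hm.two_le
        have : 0 < m := Nat.pos_of_ne_zero hm0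
        nlinarith
      obtain ⟨p, hp, hpm, hqp⟩ := ih m hlt hm0 h
      exact ⟨p, hp, hpm.trans ⟨_, by rw [mul_comm]; exact hmm⟩, hqp⟩

lemma int_below {R : Type*} [CommRing R] [IsDomain R] {q : R} (hq : Prime q) {p : ℤ} (hp : Prime p) (hqp : q ∣ (p:R)) {m : ℤ}
   (hm : q ∣ (m:R)) : p ∣ m := by
  by_contra h
  obtain ⟨u, v, huv⟩ := (hp.coprime_iff_not_dvd).2 h
  have := congrArg (Int.cast : ℤ → R) huv
  push_cast at this
  apply hq.not_isUnit
  apply isUnit_of_dvd_one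
  rw [← this]
  exact dvd_add (hqp.mul_left _) (hm.mul_left _)

open Polynomial NumberField

noncomputable def FF : ℤ[X] := X^6-4*X^5+8*X^4-8*X^3+4*X

noncomputable def ev : ℤ[X] →+* OK := (aeval zO : ℤ[X] →ₐ[ℤ] OK).toRingHom
lemma ev_X : ev X = zO := by unfold ev; simp
lemma ev_int (n : ℤ) : ev (n:ℤ[X]) = (n:OK) := map_intCast _ _
lemma ev_FF : ev FF = 0 := by
  unfold FF
  simp only [map_add, map_sub, map_mul, map_pow, ev_X, map_ofNat]
  linear_combination zO*zO_P

lemma Nm.eq2 {A T C : ℤ[X]} {j : ℕ} {n : ℤ} (h : Nm A T C (j+1) n) :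
   A*C = (T+(X:ℤ[X])^3*((2^j*n:ℤ):ℤ[X]))^2 - ((2^j*n:ℤ):ℤ[X])^2*FF := by
  rw [h.wk.eq]; unfold GG FF; push_cast; ring

lemma delta {q : OK} (hq : Prime q) (hq2 : ¬ q ∣ 2) (h : q ∣ 5*zO^3-16*zO^2+24*zO-16) :
    q ∣ 277 ∧ q ∣ zO - 23 := by
  have h4 : ¬ q ∣ 4 := by
    intro h; apply hq2; apply hq.dvd_of_dvd_pow (n := 2)
    have : (2:OK)^2 = 4 := by norm_num
    rwa [this]
  constructor
  · have : q ∣ 4*277 := by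
      have e : (4:OK)*277 = (5*zO^3-16*zO^2+24*zO-16)*(1136+772*zO-1841*zO^2+1096*zO^3-438*zO^4) := by
        linear_combination (4821-3728*zO+2190*zO^2)*zO_P
      rw [e]; exact h.mul_right _
    exact (hq.dvd_or_dvd this).resolve_left h4
  · have : q ∣ 4*(zO-23) := by
      have e : (4:OK)*(zO-23) = (5*zO^3-16*zO^2+24*zO-16)*(-88-60*zO+143*zO^2-85*zO^3+34*zO^4) := by
        linear_combination (-375+289*zO-170*zO^2)*zO_P
      rw [e]; exact h.mul_right _
    exact (hq.dvd_or_dvd this).resolve_left h4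

lemma p277 : Prime (277:ℤ) := by
  rw [Int.prime_iff_natAbs_prime]; norm_num

lemma ev_cong {q : OK} (h : q ∣ zO - 23) (f : ℤ[X]) : q ∣ ev f - ((f.eval 23 : ℤ):OK) := by
  have h1 : (X - C 23 : ℤ[X]) ∣ f - C (f.eval 23) := X_sub_C_dvd_sub_C_eval
  obtain ⟨g, hg⟩ := h1
  have := congrArg ev hg
  have hc : ∀ n : ℤ, ev (C n) = (n:OK) := fun n => by
    have h := ev_int n
    rwa [← C_eq_intCast] at h
  rw [map_sub, map_mul, map_sub, ev_X, hc, hc] at this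
  rw [this]
  exact Dvd.dvd.mul_right (by simpa using h) _

lemma noq_dvd {A T C : ℤ[X]} {j : ℕ} {n : ℤ} (h : Nm A T C (j+1) n) {q : OK} (hq : Prime q) (hq2 : ¬ q ∣ 2)
   (hA : q ∣ ev A) (hC : q ∣ ev C) : q ∣ ((2^j*n:ℤ):OK) := by
  have heq := h.eq2
  set N1 : ℤ := 2^j*n with hN1
  set B := T+(X:ℤ[X])^3*(N1:ℤ[X]) with hB
  have hB1 : q ∣ ev B := by
    apply hq.dvd_of_dvd_pow (n := 2)
    have := congrArg ev heq
    rw [map_mul, map_sub, map_pow, map_mul, ev_FF, mul_zero, sub_zero] at this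
    rw [← this]; exact hA.mul_right _
  by_contra hcon
  have hdd := congrArg (fun f => ev (derivative f)) heq
  have hFd : derivative FF = 6*X^5-20*X^4+32*X^3-24*X^2+4 := by
    unfold FF
    simp only [derivative_add, derivative_sub, derivative_mul, derivative_X_pow, derivative_ofNat, derivative_X]
    simp
    ring
  simp only [derivative_mul, derivative_sub, hFd, derivative_pow, derivative_intCast] at hdd
  simp only [map_add, map_sub, map_mul, map_pow, ev_X, ev_int, ev_FF, map_ofNat, map_zero] at hdd
  have e : (N1:OK)^2*(zO^2*(5*zO^3-16*zO^2+24*zO-16)) = ev B * (2*ev (derivative B)) - ev A * ev (derivative C) - ev C * ev (derivative A) := by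
    have hC2 : ev (Polynomial.C (2:ℤ)) = 2 := by
      have := ev_int 2
      simpa using this
    simp only [Nat.cast_ofNat, hC2] at hdd
    linear_combination hdd - (N1:OK)^2*zO_P
  have hd : q ∣ (N1:OK)^2*(zO^2*(5*zO^3-16*zO^2+24*zO-16)) := by
    rw [e]
    exact dvd_sub (dvd_sub (hB1.mul_right _) (hA.mul_right _)) (hC.mul_right _)
  have hz : ¬ q ∣ zO := by
    intro hz
    apply hq2; apply hq.dvd_of_dvd_pow (n := 2)
    have : (2:OK)^2 = zO*(-(zO*kap)) := by linear_combination four_kap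
    rw [this]; exact hz.mul_right _
  rcases hq.dvd_or_dvd hd with hd | hd
  · exact hcon (hq.dvd_of_dvd_pow hd)
  rcases hq.dvd_or_dvd hd with hd | hd
  · exact hz (hq.dvd_of_dvd_pow hd)
  obtain ⟨h277, h23⟩ := delta hq hq2 hd
  have h277' : q ∣ ((277:ℤ):OK) := by exact_mod_cast h277
  have low : ∀ f : ℤ[X], q ∣ ev f → (277:ℤ) ∣ f.eval 23 := by
    intro f hf
    apply int_below hq p277 h277'
    exact (dvd_sub_right hf).1 (ev_cong h23 f)
  obtain ⟨x, hx⟩ := low A hA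
  obtain ⟨y, hy⟩ := low C hC
  obtain ⟨w, hw⟩ := low B hB1
  have he := congrArg (Polynomial.eval 23) heq
  simp only [eval_mul, eval_sub, eval_pow, hx, hy, hw, eval_intCast] at he
  have hF : eval 23 FF = 277*449213 := by unfold FF; simp
  rw [hF] at he
  have h1 : 277 ∣ N1^2*449213 := ⟨w^2-x*y, by
    simp only [Int.cast_id] at he
    have : 277*(N1^2*449213) = 277*(277*(w^2-x*y)) := by linear_combination he
    exact mul_left_cancel₀ (by norm_num) this⟩
  have h2 : (277:ℤ) ∣ N1 := by
    rcases p277.dvd_or_dvd h1 with h | h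
    · exact p277.dvd_of_dvd_pow h
    · norm_num at h
  obtain ⟨k, hk⟩ := h2
  apply hcon
  rw [hk, Int.cast_mul]
  exact h277'.mul_right _

lemma noq {A T C : ℤ[X]} {j : ℕ} {n : ℤ} (h : Nm A T C (j+1) n) {q : OK} (hq : Prime q) (hq2 : ¬ q ∣ 2)
   (hA : q ∣ ev A) (hC : q ∣ ev C) : False := by
  have hN := noq_dvd h hq hq2 hA hC
  have hqn : q ∣ (n:OK) := by
    rw [Int.cast_mul, Int.cast_pow] at hN
    refine (hq.dvd_or_dvd hN).resolve_left fun h => hq2 ?_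
    exact_mod_cast hq.dvd_of_dvd_pow h
  have hn0 : n ≠ 0 := fun h0 => h.odd (h0 ▸ dvd_zero _)
  have hqn' : q ∣ ((n.natAbs:ℕ):OK) := by
    rw [← Int.cast_natCast]
    rcases Int.natAbs_eq n with e | e
    · have e2 : ((n.natAbs:ℕ):ℤ) = n := e.symm
      rw [e2]; exact hqn
    · have e2 : ((n.natAbs:ℕ):ℤ) = -n := by omega
      rw [e2, Int.cast_neg, dvd_neg]; exact hqn
  obtain ⟨p, hp, hpn, hqp⟩ := prime_below hq n.natAbs (by simpa using hn0) hqn'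
  have hpn' : (p:ℤ) ∣ n := Int.natCast_dvd.2 hpn
  have hpp : Prime (p:ℤ) := Nat.prime_iff_prime_int.1 hp
  have hp2 : ¬ (2:ℤ) ∣ p := fun h2 => h.odd (h2.trans hpn')
  have : Fact p.Prime := ⟨hp⟩
  let I : Ideal OK := Ideal.span {q}
  have hIp : I.IsPrime := (Ideal.span_singleton_prime hq.ne_zero).2 hq
  let R := OK ⧸ I
  let mk : OK →+* R := Ideal.Quotient.mk I
  have mk0 : ∀ x, q ∣ x → mk x = 0 := fun x hx =>
    Ideal.Quotient.eq_zero_iff_mem.2 (Ideal.mem_span_singleton.2 hx)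
  have : IsDomain R := inferInstanceAs (IsDomain (OK ⧸ I))
  have hp0 : (p:R) = 0 := by
    have := mk0 _ hqp
    rwa [map_natCast] at this
  have : CharP R p := by
    have := CharP.ringChar_of_prime_eq_zero hp hp0
    exact this ▸ ringChar.charP R
  let φ : ZMod p →+* R := ZMod.castHom dvd_rfl R
  obtain ⟨a0, a1, a2, eA⟩ := dg2 h.wk.hA
  obtain ⟨t0, t1, t2, t3, eT⟩ := dg3 h.wk.hT
  obtain ⟨c0, c1, c2, c3, c4, eC⟩ := dg4 h.wk.hC
  obtain ⟨e0,e1,e2,e3,e4,e5,e6⟩ := h.wk.coeffs eA eT eC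
  have nz : ((2^(j+1)*n : ℤ) : ZMod p) = 0 := (ZMod.intCast_zmod_eq_zero_iff_dvd _ p).2 (hpn'.mul_left _)
  generalize (2^(j+1)*n : ℤ) = N at *
  have hφ : ∀ m : ℤ, φ (m : ZMod p) = mk (m:OK) := fun m => by rw [map_intCast, map_intCast]
  replace e0 := congrArg (Int.cast : ℤ → ZMod p) e0
  replace e1 := congrArg (Int.cast : ℤ → ZMod p) e1
  replace e2 := congrArg (Int.cast : ℤ → ZMod p) e2
  replace e3 := congrArg (Int.cast : ℤ → ZMod p) e3
  replace e4 := congrArg (Int.cast : ℤ → ZMod p) e4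
  replace e5 := congrArg (Int.cast : ℤ → ZMod p) e5
  replace e6 := congrArg (Int.cast : ℤ → ZMod p) e6
  push_cast at e0 e1 e2 e3 e4 e5 e6
  rw [nz] at e1 e3 e4 e5 e6
  have hz : φ (a0:ZMod p) + φ (a1:ZMod p) * mk zO + φ (a2:ZMod p) * (mk zO)^2 = 0 := by
    have := mk0 _ hA
    rw [eA] at this
    simp only [map_add, map_mul, map_pow, ev_X, ev_int] at this
    rw [hφ, hφ, hφ]; exact this
  have hc : φ (c0:ZMod p) + φ (c1:ZMod p) * mk zO + φ (c2:ZMod p) * (mk zO)^2 + φ (c3:ZMod p) * (mk zO)^3 + φ (c4:ZMod p) * (mk zO)^4 = 0 := by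
    have := mk0 _ hC
    rw [eC] at this
    simp only [map_add, map_mul, map_pow, ev_X, ev_int] at this
    rw [hφ, hφ, hφ, hφ, hφ]; exact this
  have hA0 : ¬ ((a0:ZMod p) = 0 ∧ (a1:ZMod p) = 0 ∧ (a2:ZMod p) = 0) := by
    rintro ⟨h0, h1, h2⟩
    rw [ZMod.intCast_zmod_eq_zero_iff_dvd] at h0 h1 h2
    obtain ⟨x, hx⟩ := h0
    obtain ⟨y, hy⟩ := h1
    obtain ⟨z, hz⟩ := h2
    apply h.prim p hpp
    refine ⟨(x:ℤ[X])+y*(X:ℤ[X])+z*(X:ℤ[X])^2, ?_⟩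
    rw [eA, hx, hy, hz]; push_cast; ring
  obtain ⟨l0, l1, f0, f1, f2, f3⟩ := field_div φ (t3 := (t3:ZMod p)) e0 (by linear_combination e1) e2
    (by linear_combination e3) (by linear_combination e4) (by linear_combination e5) (by linear_combination e6) hA0 hz hc
  obtain ⟨l0, rfl⟩ := ZMod.intCast_surjective l0
  obtain ⟨l1, rfl⟩ := ZMod.intCast_surjective l1
  have g : ∀ x y : ℤ, (x : ZMod p) = (y:ZMod p) → (p:ℤ) ∣ x - y := fun x y hxy => by
    rw [← ZMod.intCast_zmod_eq_zero_iff_dvd]; push_cast; rw [hxy, sub_self]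
  obtain ⟨x0, g0⟩ := g t0 (a0*l0) (by push_cast; exact f0)
  obtain ⟨x1, g1⟩ := g t1 (a0*l1+a1*l0) (by push_cast; exact f1)
  obtain ⟨x2, g2⟩ := g t2 (a1*l1+a2*l0) (by push_cast; exact f2)
  obtain ⟨x3, g3⟩ := g t3 (a2*l1) (by push_cast; exact f3)
  apply h.minn p hpp hp2 hpn' (l0+l1*(X:ℤ[X])) (dg1' l0 l1)
  refine ⟨(x0:ℤ[X])+x1*(X:ℤ[X])+x2*(X:ℤ[X])^2+x3*(X:ℤ[X])^3, ?_⟩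
  rw [eA, eT]
  have g0' := congrArg (Int.cast : ℤ → ℤ[X]) g0
  have g1' := congrArg (Int.cast : ℤ → ℤ[X]) g1
  have g2' := congrArg (Int.cast : ℤ → ℤ[X]) g2
  have g3' := congrArg (Int.cast : ℤ → ℤ[X]) g3
  push_cast at g0' g1' g2' g3' ⊢
  linear_combination g0' + (X:ℤ[X])*g1' + (X:ℤ[X])^2*g2'+(X:ℤ[X])^3*g3'

open Polynomial NumberField

lemma zO_ne : zO ≠ 0 := by
  intro h
  have := four_kap
  rw [h] at this
  have h4 : (4:OK) ≠ 0 := by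
    have : (4:OK) = 2*2 := by norm_num
    rw [this]; exact mul_ne_zero two_ne_zero two_ne_zero
  apply h4; rw [this]; ring

lemma pi6_kap : piK^6 ∣ kap := by
  unfold kap
  obtain ⟨g, hg⟩ : ∃ g, zO = piK^2*g := ⟨_, zO_pi⟩
  refine ⟨g^3 + piK^4*eK^2*(2*zO-2-zO^2), ?_⟩
  have h4 : (4:OK) = piK^6*(piK^4*eK^2) := by
    have : (4:OK) = 2*2 := by norm_num
    rw [this, two_eq']; ring
  have h3 : zO^3 = piK^6*g^3 := by rw [hg]; ring
  linear_combination h3 + (2*zO-2-zO^2)*h4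

lemma pi6_four : piK^6 ∣ (4:OK) := by
  refine ⟨piK^4*eK^2, ?_⟩
  have : (4:OK) = 2*2 := by norm_num
  rw [this, two_eq']; ring

lemma pi6_twoz : piK^6 ∣ 2*zO := by
  refine ⟨piK*eK*(-5-6*piK-12*piK^2-10*piK^3-2*piK^4), ?_⟩
  linear_combination zO*two_eq' + piK^5*eK*zO_pi

lemma pi_dvd_zO : piK ∣ zO := ⟨piK*(-5-6*piK-12*piK^2-10*piK^3-2*piK^4), by rw [zO_pi]; ring⟩

lemma selmer_core {A T C : ℤ[X]} {j : ℕ} {n : ℤ} (h : Nm A T C (j+1) n) {α ρ β t : OK}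
   (eA : ev A = ρ^2*α) (hβ : α * ev C = β^2) (ht : ¬ piK ∣ t) (hα : piK^6 ∣ α - t^2) : ∃ s, ev A = s^2 := by
  have hpa : ¬ piK ∣ α := by
    intro ha
    apply ht; apply pi_prime.dvd_of_dvd_pow (n := 2)
    exact (dvd_sub_right ha).1 ((dvd_pow_self _ (by norm_num)).trans hα)
  have := pid
  have hco : IsCoprime α (ev C) := by
    apply isCoprime_of_prime_dvd
    · rintro ⟨h0, -⟩; exact hpa (h0 ▸ dvd_zero _)
    · intro q hq hqa hqc
      by_cases hq2 : q ∣ 2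
      · rw [two_eq'] at hq2
        rcases hq.dvd_or_dvd hq2 with h2 | h2
        · have h3 := hq.dvd_of_dvd_pow h2
          have := (hq.dvd_prime_iff_associated pi_prime).1 h3
          exact hpa (this.symm.dvd.trans hqa)
        · exact hq.not_isUnit (isUnit_of_dvd_unit h2 eK_unit)
      · exact noq h hq hq2 (by rw [eA]; exact hqa.mul_left _) hqc
  obtain ⟨d, u, hd⟩ := exists_associated_pow_of_mul_eq_pow' hco hβ
  have hs : ¬ piK ∣ d := by
    intro hpd; apply hpa; rw [← hd]; exact (dvd_pow hpd (by norm_num)).mul_right _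
  obtain ⟨w, hw⟩ := unit_square u d t hs ht (by rw [mul_comm, hd]; exact hα)
  refine ⟨ρ*d*w, ?_⟩
  rw [eA, ← hd, hw]; push_cast; ring

lemma selmer_odd {A T C : ℤ[X]} {j : ℕ} {n : ℤ} (h : Nm A T C (j+1) n) {a0 a1 a2 : ℤ}
    (eA : A = a0 + a1 * (X:ℤ[X]) + a2 * (X:ℤ[X])^2) (h0 : 4 ∣ a0 - 1) (h1 : 2 ∣ a1) : ∃ s, ev A = s^2 := by
  have heq : ev A * ev C = (ev (T+(X:ℤ[X])^3*((2^j*n:ℤ):ℤ[X])))^2 := by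
    have := congrArg ev h.eq2
    rw [map_mul, map_sub, map_pow, map_mul, ev_FF, mul_zero, sub_zero] at this
    exact this
  have e : ev A = a0+a1*zO+a2*zO^2 := by
    rw [eA]; simp only [map_add, map_mul, map_pow, ev_X, ev_int]
  obtain ⟨k, hk⟩ := h0
  obtain ⟨b, rfl⟩ := h1
  obtain rfl : a0 = 1+4*k := by omega
  obtain ⟨d, hd⟩ : ∃ d, a2 = 2*d ∨ a2 = 2*d+1 := ⟨a2/2, by omega⟩
  rcases hd with rfl | rfl
  · refine selmer_core h (α := ev A) (ρ := 1) (t := 1) (by ring) heq (fun h => pi_prime.not_isUnit (isUnit_of_dvd_one h)) ?_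
    have : ev A - 1^2 = 4*k+2*zO*(b+d*zO) := by rw [e]; push_cast; ring
    rw [this]
    exact dvd_add (pi6_four.mul_right _) (pi6_twoz.mul_right _)
  · refine selmer_core h (α := ev A) (ρ := 1) (t := 1+zO) (by ring) heq (fun h => pi_prime.not_isUnit (isUnit_of_dvd_one ((dvd_add_left pi_dvd_zO).1 h))) ?_
    have : ev A - (1+zO)^2 = 4*k+2*zO*(b-1+d*zO) := by rw [e]; push_cast; ring
    rw [this]
    exact dvd_add (pi6_four.mul_right _) (pi6_twoz.mul_right _)

lemma selmer_even {A T C : ℤ[X]} {j : ℕ} {n : ℤ} (h : Nm A T C (j+1) n) {a0 a1 a2 : ℤ}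
    (eA : A = a0 + a1 * (X:ℤ[X]) + a2 * (X:ℤ[X])^2) (h0 : 4 ∣ a0) (h1 : 4 ∣ a1) (h2 : 4 ∣ a2 - 1) : ∃ s, ev A = s^2 := by
  have heq : ev A * ev C = (ev (T+(X:ℤ[X])^3*((2^j*n:ℤ):ℤ[X])))^2 := by
    have := congrArg ev h.eq2
    rw [map_mul, map_sub, map_pow, map_mul, ev_FF, mul_zero, sub_zero] at this
    exact this
  obtain ⟨x, rfl⟩ := h0
  obtain ⟨y, rfl⟩ := h1
  obtain ⟨k, hk⟩ := h2
  obtain rfl : a2 = 1+4*k := by omega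
  have e : ev A = zO^2*(1+4*k-kap*(x+y*zO)) := by
    rw [eA]; simp only [map_add, map_mul, map_pow, ev_X, ev_int]; push_cast
    linear_combination (x+y*zO)*four_kap
  rw [e] at heq
  have hz : zO^2 ∣ (ev (T+(X:ℤ[X])^3*((2^j*n:ℤ):ℤ[X])))^2 := ⟨(1+4*k-kap*(x+y*zO))*ev C, by rw [← heq]; ring⟩
  rw [IsIntegrallyClosed.pow_dvd_pow_iff (by norm_num)] at hz
  obtain ⟨β, hβ⟩ := hz
  rw [hβ] at heq
  refine selmer_core h (t := 1) (β := β) e ?_ (fun h => pi_prime.not_isUnit (isUnit_of_dvd_one h)) ?_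
  · apply mul_left_cancel₀ (pow_ne_zero 2 zO_ne)
    linear_combination heq
  · have : (1+4*k-kap*(x+y*zO)) - 1^2 = 4*k-kap*(x+y*zO) := by ring
    rw [this]
    exact dvd_sub (pi6_four.mul_right _) (pi6_kap.mul_right _)

lemma selmer {A T C : ℤ[X]} {j : ℕ} {n : ℤ} (h : Nm A T C (j+1) n) :
    ∃ A C, Nm A T C (j+1) n ∧ ∃ s, ev A = s^2 := by
  obtain ⟨a0, a1, a2, eA⟩ := dg2 h.wk.hA
  obtain ⟨t0, t1, t2, t3, eT⟩ := dg3 h.wk.hT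
  obtain ⟨c0, c1, c2, c3, c4, eC⟩ := dg4 h.wk.hC
  have h2N : (2:ℤ) ∣ 2^(j+1)*n := ⟨2^j*n, by ring⟩
  obtain ⟨m1, -, -, -, -, -, -, m8⟩ := mod2 eA eT eC (h.wk.two h2N) h.wk.notin
  have eA' : -A = ((-a0:ℤ):ℤ[X]) + ((-a1:ℤ):ℤ[X]) * (X:ℤ[X]) + ((-a2:ℤ):ℤ[X]) * (X:ℤ[X])^2 := by
    rw [eA]; push_cast; ring
  by_cases ha : 2 ∣ a0
  · obtain ⟨e0,e1,-⟩ := h.wk.coeffs eA eT eC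
    have hca : ¬ 2 ∣ c0*a2 := fun hx => m8 (dvd_add (dvd_add hx ((ha.mul_left _).mul_right _)) (ha.mul_left _))
    have hc : ¬ 2 ∣ c0 := fun hx => hca (hx.mul_right _)
    have ha2 : ¬ 2 ∣ a2 := fun hx => hca (hx.mul_left _)
    have ht : 2 ∣ t0 := Int.prime_two.dvd_of_dvd_pow (n := 2) (by rw [← e0]; exact ha.mul_right _)
    have hco : IsCoprime (4:ℤ) c0 := by
      have : IsCoprime (2:ℤ) c0 := (Int.prime_two.coprime_iff_not_dvd).2 hc
      exact this.pow_left (m := 2)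
    obtain ⟨t, rfl⟩ := ht
    have h4 : 4 ∣ a0 := hco.dvd_of_dvd_mul_right (by rw [e0]; exact ⟨t^2, by ring⟩)
    have h41 : 4 ∣ a1 := by
      apply hco.dvd_of_dvd_mul_right
      have : a1*c0 = 4*(t*t1-(2^j*n)^2) - a0*c1 := by linear_combination e1
      rw [this]
      exact dvd_sub (dvd_mul_right _ _) (h4.mul_right _)
    rcases (show 4 ∣ a2 - 1 ∨ 4 ∣ -a2-1 by omega) with h5 | h5
    · exact ⟨A, C, h, selmer_even h eA h4 h41 h5⟩
    · exact ⟨-A, -C, h.neg, selmer_even h.neg eA' (by omega) (by omega) h5⟩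
  · rcases (show 4 ∣ a0 - 1 ∨ 4 ∣ -a0-1 by omega) with h5 | h5
    · exact ⟨A, C, h, selmer_odd h eA h5 m1⟩
    · exact ⟨-A, -C, h.neg, selmer_odd h.neg eA' h5 (by omega)⟩

open Polynomial NumberField

noncomputable def zK : KK := algebraMap OK KK zO
noncomputable def evK : ℤ[X] →+* KK := (algebraMap OK KK).comp ev
lemma evK_X : evK X = zK := by simp [evK, ev_X, zK]
lemma evK_int (n : ℤ) : evK (n:ℤ[X]) = (n:KK) := map_intCast _ _

lemma indepZ {x0 x1 x2 x3 x4 : ℚ} (h : (x0:KK)+x1*zK+x2*zK^2+x3*zK^3+x4*zK^4=0) :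
    x0=0 ∧ x1=0 ∧ x2=0 ∧ x3=0 ∧ x4=0 := by
  set r : KK := AdjoinRoot.root qQ with hr
  have hzr : zK = -4+4*r-13*r^2-18*r^3-4*r^4 := by
    have : algebraMap OK KK piK = r := rfl
    simp only [zK, zO, map_add, map_sub, map_mul, map_pow, map_neg, map_ofNat, this]
  obtain ⟨h2, h3, h4, -⟩ := zeta_pows r zK root_eq hzr
  rw [h4, h3, h2, hzr] at h
  have hb := Fintype.linearIndependent_iff.1 bK.linearIndependent
    ![x0-4*x1-8*x2+4*x3+40*x4, 4*x1+8*x2+2*x3-20*x4, -13*x1-24*x2+4*x3+92*x4, -18*x1-32*x2+8*x3+126*x4, -4*x1-7*x2+2*x3+28*x4] (by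
      simp only [Fin.sum_univ_five, bK_apply, Rat.smul_def]
      simp
      rw [← hr]
      linear_combination h)
  have b0 := hb 0
  have b1 := hb 1
  have b2 := hb 2
  have b3 := hb 3
  have b4 := hb 4
  simp at b0 b1 b2 b3 b4
  refine ⟨?_, ?_, ?_, ?_, ?_⟩ <;> linarith

noncomputable def zB : Module.Basis (Fin 5) ℚ KK :=
  basisOfLinearIndependentOfCardEqFinrank (b := fun i : Fin 5 => zK^(i:ℕ)) (by
    rw [Fintype.linearIndependent_iff]
    intro g hg
    simp only [Fin.sum_univ_five, Rat.smul_def] at hg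
    have := indepZ (x0 := g 0) (x1 := g 1) (x2 := g 2) (x3 := g 3) (x4 := g 4) (by
      simp at hg; exact hg)
    obtain ⟨h0,h1,h2,h3,h4⟩ := this
    intro i; fin_cases i <;> assumption) (by rw [finrankK]; rfl)

lemma zB_expand (x : KK) : x = (zB.repr x 0:KK)+(zB.repr x 1:KK)*zK+(zB.repr x 2:KK)*zK^2+(zB.repr x 3:KK)*zK^3+(zB.repr x 4:KK)*zK^4 := by
  have := zB.sum_repr x
  simp only [Fin.sum_univ_five, Rat.smul_def, zB, coe_basisOfLinearIndependentOfCardEqFinrank] at this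
  simp at this
  exact this.symm

lemma ker32 (p q r p' q' r' : ℚ) : ∃ x y z : ℚ, ¬ (x = 0 ∧ y = 0 ∧ z = 0) ∧ p*x+q*y+r*z=0 ∧ p'*x+q'*y+r'*z=0 := by
  let M : Matrix (Fin 2) (Fin 3) ℚ := !![p,q,r;p',q',r']
  have hk : LinearMap.ker M.mulVecLin ≠ ⊥ := M.mulVecLin.ker_ne_bot_of_finrank_lt (by simp)
  obtain ⟨v, hv, hv0⟩ := Submodule.exists_mem_ne_zero_of_ne_bot hk
  rw [LinearMap.mem_ker, Matrix.mulVecLin_apply] at hv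
  refine ⟨v 0, v 1, v 2, ?_, ?_, ?_⟩
  · rintro ⟨h0,h1,h2⟩
    apply hv0; ext i; fin_cases i <;> assumption
  · have := congrFun hv 0
    simpa [M, Matrix.mulVec, dotProduct, Fin.sum_univ_three] using this
  · have := congrFun hv 1
    simpa [M, Matrix.mulVec, dotProduct, Fin.sum_univ_three] using this

lemma scale3 (x y z : ℚ) (h : ¬ (x = 0 ∧ y = 0 ∧ z = 0)) : ∃ (a b c : ℤ) (r : ℚ), (a:ℚ)=r*x ∧ (b:ℚ)=r*y ∧ (c:ℚ)=r*z ∧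
    ¬ ((2:ℤ) ∣ a ∧ (2:ℤ) ∣ b ∧ (2:ℤ) ∣ c) := by
  have hx := Rat.mul_den_eq_num x
  have hy := Rat.mul_den_eq_num y
  have hz := Rat.mul_den_eq_num z
  have dx : (x.den:ℚ) ≠ 0 := by exact_mod_cast x.den_nz
  have dy : (y.den:ℚ) ≠ 0 := by exact_mod_cast y.den_nz
  have dz : (z.den:ℚ) ≠ 0 := by exact_mod_cast z.den_nz
  obtain ⟨a, b, c, r, hr, ha, hb, hc⟩ : ∃ (a b c : ℤ) (r : ℚ), r ≠ 0 ∧ (a:ℚ)=r*x ∧ (b:ℚ)=r*y ∧ (c:ℚ)=r*z := by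
    refine ⟨x.num*y.den*z.den, y.num*x.den*z.den, z.num*x.den*y.den, x.den*y.den*z.den, by positivity, ?_, ?_, ?_⟩
    · push_cast; linear_combination -(y.den*z.den:ℚ)*hx
    · push_cast; linear_combination -(x.den*z.den:ℚ)*hy
    · push_cast; linear_combination -(x.den*y.den:ℚ)*hz
  set d : ℤ := gcd a (gcd b c) with hd
  have d0 : d ≠ 0 := by
    intro h0
    rw [hd, gcd_eq_zero_iff, gcd_eq_zero_iff] at h0
    obtain ⟨rfl, rfl, rfl⟩ := h0
    apply h
    refine ⟨?_, ?_, ?_⟩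
    · simpa [hr] using ha.symm
    · simpa [hr] using hb.symm
    · simpa [hr] using hc.symm
  have d0' : (d:ℚ) ≠ 0 := by exact_mod_cast d0
  obtain ⟨a', ea⟩ : d ∣ a := gcd_dvd_left _ _
  obtain ⟨b', eb⟩ : d ∣ b := (gcd_dvd_right a _).trans (gcd_dvd_left _ _)
  obtain ⟨c', ec⟩ : d ∣ c := (gcd_dvd_right a _).trans (gcd_dvd_right _ _)
  refine ⟨a', b', c', r/d, ?_, ?_, ?_, ?_⟩
  · rw [ea] at ha; push_cast at ha; field_simp; linear_combination ha
  · rw [eb] at hb; push_cast at hb; field_simp; linear_combination hb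
  · rw [ec] at hc; push_cast at hc; field_simp; linear_combination hc
  · rintro ⟨⟨u, hu⟩, ⟨v, hv⟩, ⟨w, hw⟩⟩
    have : d*2 ∣ d := by
      conv_rhs => rw [hd]
      apply dvd_gcd
      · exact ⟨u, by rw [ea, hu]; ring⟩
      apply dvd_gcd
      · exact ⟨v, by rw [eb, hv]; ring⟩
      · exact ⟨w, by rw [ec, hw]; ring⟩
    obtain ⟨k, hk⟩ := this
    have : 1 = 2*k := mul_left_cancel₀ d0 (by linear_combination hk)
    omega

lemma rat_int {x : ℚ} {n : ℤ} (h : x^2 = n) : ∃ m : ℤ, x = m := by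
  have : IsIntegral ℤ (x^2) := by rw [h]; exact isIntegral_algebraMap (R := ℤ) (A := ℚ) (x := n)
  obtain ⟨m, hm⟩ := IsIntegrallyClosed.exists_algebraMap_eq_of_isIntegral_pow (by norm_num) this
  exact ⟨m, by rw [← hm]; simp⟩

theorem halving {A T C : ℤ[X]} {j : ℕ} {n : ℤ} (h : Nm A T C (j+1) n) {s : OK} (hs : ev A = s^2) :
   ∃ (A1 T1 C1 : ℤ[X]) (j' : ℕ) (n' : ℤ), 1 ≤ j' ∧ j' < j+1 ∧ ¬ 2 ∣ n' ∧ Wk A1 T1 C1 (2^j'*n') := by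
  set N : ℤ := 2^(j+1)*n with hN
  have h2N : (2:ℤ) ∣ N := ⟨2^j*n, by rw [hN]; ring⟩
  set b1 : KK := evK (T+(X:ℤ[X])^3*((2^j*n:ℤ):ℤ[X])) with hb1
  set σ : KK := algebraMap OK KK s with hσ
  have hA : evK A = σ^2 := by
    show algebraMap OK KK (ev A) = _
    rw [hs, map_pow]
  have hAC : evK A * evK C = b1^2 := by
    have := congrArg evK h.eq2
    have hF : evK FF = 0 := by
      show algebraMap OK KK (ev FF) = 0
      rw [ev_FF, map_zero]
    rw [map_mul, map_sub, map_pow, map_mul, hF, mul_zero, sub_zero] at this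
    exact this
  have hσ0 : σ ≠ 0 := by
    intro h0
    rw [h0] at hA
    obtain ⟨a0, a1, a2, eA⟩ := dg2 h.wk.hA
    rw [eA] at hA
    simp only [map_add, map_mul, map_pow, evK_X, evK_int] at hA
    obtain ⟨i0, i1, i2, -⟩ := indepZ (x0 := a0) (x1 := a1) (x2 := a2) (x3 := 0) (x4 := 0) (by
      push_cast; linear_combination hA)
    apply h.prim 2 Int.prime_two
    have i0' : a0 = 0 := by exact_mod_cast i0
    have i1' : a1 = 0 := by exact_mod_cast i1
    have i2' : a2 = 0 := by exact_mod_cast i2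
    rw [eA, i0', i1', i2']; simp
  set β : KK := b1/σ with hβ
  have hβσ : σ*β = b1 := by rw [hβ]; field_simp
  have hC : evK C = β^2 := by
    apply mul_left_cancel₀ (pow_ne_zero 2 hσ0)
    rw [← hA, hAC, ← hβσ, hA]; ring
  obtain ⟨v, y, z, hne, k1, k2⟩ := ker32 (-zB.repr β 3) (zB.repr σ 3) (zB.repr (σ*zK) 3) (-zB.repr β 4) (zB.repr σ 4) (zB.repr (σ*zK) 4)
  obtain ⟨v0, l0, l1, r, hv, h0, h1, hodd⟩ := scale3 v y z hne
  have k1' : (-zB.repr β 3)*v0+(zB.repr σ 3)*l0+(zB.repr (σ*zK) 3)*l1 = 0 := by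
    rw [hv, h0, h1]; linear_combination r*k1
  have k2' : (-zB.repr β 4)*v0+(zB.repr σ 4)*l0+(zB.repr (σ*zK) 4)*l1 = 0 := by
    rw [hv, h0, h1]; linear_combination r*k2
  obtain ⟨α0, α1, α2, hα⟩ : ∃ α0 α1 α2 : ℚ, σ*(l0+l1*zK)-v0*β = α0+α1*zK+α2*zK^2 := by
    refine ⟨-zB.repr β 0*v0+zB.repr σ 0*l0+zB.repr (σ*zK) 0*l1, -zB.repr β 1*v0+zB.repr σ 1*l0+zB.repr (σ*zK) 1*l1,
      -zB.repr β 2*v0+zB.repr σ 2*l0+zB.repr (σ*zK) 2*l1, ?_⟩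
    have e1 := zB_expand β
    have e2 := zB_expand σ
    have e3 := zB_expand (σ*zK)
    have k1'' := congrArg (Rat.cast : ℚ → KK) k1'
    have k2'' := congrArg (Rat.cast : ℚ → KK) k2'
    push_cast at k1'' k2'' ⊢
    linear_combination (-v0:KK)*e1+(l0:KK)*e2+(l1:KK)*e3+zK^3*k1''+zK^4*k2''
  set lam : ℤ[X] := l0+l1*(X:ℤ[X]) with hlam
  have dlam : dg 1 lam := dg1' _ _
  set Q : ℤ[X] := A*lam^2 - v0*lam*(2*T+(X:ℤ[X])^3*N)+v0^2*C with hQ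
  have dQ : dg 4 Q := by
    refine ((h.wk.hA.mul (dlam.pow 2 (k := 2) (by norm_num)) (by norm_num)).sub ?_).add ?_
    · refine ((dg_int 0 v0).mul dlam (k := 1) (by norm_num)).mul (m := 1) (n := 3) ?_ (by norm_num)
      refine dg.add ?_ ?_
      · exact (dg_int 0 2).mul h.wk.hT (by norm_num)
      · exact ((dg_X le_rfl).pow 3 (k := 3) (by norm_num)).mul (dg_int 0 N) (by norm_num)
    · exact ((dg_int 0 v0).pow 2 (k := 0) (by norm_num)).mul h.wk.hC (by norm_num)
  have hQe : evK Q = (σ*(l0+l1*zK)-v0*β)^2 := by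
    have e1 : evK lam = l0+l1*zK := by simp only [hlam, map_add, map_mul, evK_int, evK_X]
    have e2 : evK (2*T+(X:ℤ[X])^3*N) = 2*b1 := by
      rw [hb1, ← map_ofNat evK 2, ← map_mul]
      congr 1
      rw [hN]; push_cast; ring
    rw [hQ, map_add, map_sub, map_mul, map_mul, map_mul, map_mul, e1, e2, hA, map_pow, map_pow, evK_int, hC, e1, ← hβσ]
    ring
  obtain ⟨q0, q1, q2, q3, q4, eQ⟩ := dg4 dQ
  rw [hα] at hQe
  have hQz : evK Q = q0+q1*zK+q2*zK^2+q3*zK^3+q4*zK^4 := by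
    rw [eQ]; simp only [map_add, map_mul, map_pow, evK_int, evK_X]
  obtain ⟨w0, w1, w2, w3, w4⟩ := indepZ (x0 := α0^2-q0) (x1 := 2*α0*α1-q1) (x2 := 2*α0*α2+α1^2-q2) (x3 := 2*α1*α2-q3) (x4 := α2^2-q4) (by
    push_cast; linear_combination hQz-hQe)
  obtain ⟨m0, rfl⟩ := rat_int (x := α0) (n := q0) (by linarith)
  obtain ⟨m2, rfl⟩ := rat_int (x := α2) (n := q4) (by linarith)
  obtain ⟨m1, rfl⟩ := rat_int (x := α1) (n := q2-2*m0*m2) (by push_cast; linarith)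
  have QQ : ((m0:ℤ[X])+m1*(X:ℤ[X])+m2*(X:ℤ[X])^2)^2 = Q := by
    have z0 : q0 = m0^2 := by exact_mod_cast (by linarith : (q0:ℚ) = (m0:ℚ)^2)
    have z1 : q1 = 2*m0*m1 := by exact_mod_cast (by linarith : (q1:ℚ) = 2*(m0:ℚ)*m1)
    have z2 : q2 = 2*m0*m2+m1^2 := by exact_mod_cast (by linarith : (q2:ℚ) = 2*(m0:ℚ)*m2+(m1:ℚ)^2)
    have z3 : q3 = 2*m1*m2 := by exact_mod_cast (by linarith : (q3:ℚ) = 2*(m1:ℚ)*m2)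
    have z4 : q4 = m2^2 := by exact_mod_cast (by linarith : (q4:ℚ) = (m2:ℚ)^2)
    rw [eQ, z0, z1, z2, z3, z4]; push_cast; ring
  have dA' : dg 2 ((m0:ℤ[X])+m1*(X:ℤ[X])+m2*(X:ℤ[X])^2) := dg2' _ _ _
  generalize ((m0:ℤ[X])+m1*(X:ℤ[X])+m2*(X:ℤ[X])^2) = A' at QQ dA'
  by_cases hv0 : v0 = 0
  · refine vzero h.wk h.odd (by omega) (lam := lam) (A' := A') ?_ h.prim ?_
    · intro hl
      have : q6 l0 l1 0 0 0 0 0 = 0 := by rw [← hl, hlam]; unfold q6; push_cast; ring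
      obtain ⟨g0, g1, -⟩ := q6_zero this
      apply hodd; rw [hv0, g0, g1]; simp
    · rw [QQ, hQ, hv0]; push_cast; ring
  · obtain ⟨i0, m, hvm, hm⟩ := two_pow_split hv0
    refine step2 h.wk rfl h.odd (by omega) dA' dlam hvm hm QQ ?_
    intro hd
    obtain ⟨l, w, hl, hw, m1, m2, m3, m4, -⟩ := mod2' h.wk.hA h.wk.hT h.wk.hC (h.wk.two h2N) h.wk.notin
    obtain ⟨N1, hN1⟩ := h2N
    have d1 : (2:ℤ[X]) ∣ l*lam+v0*w := by
      apply prime_two'.dvd_of_dvd_pow (n := 2)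
      have : (l*lam+v0*w)^2 = A'*A' - (A-l^2)*lam^2-v0^2*(C-w^2)+2*(v0*lam*(T+(X:ℤ[X])^3*N1)+l*lam*v0*w) := by
        have hN1' : (N:ℤ[X]) = 2*N1 := by rw [hN1]; push_cast; ring
        rw [hQ, hN1'] at QQ
        linear_combination -QQ
      rw [this]
      exact dvd_add (dvd_sub (dvd_sub (hd.mul_right _) (m1.mul_right _)) (m3.mul_left _)) (dvd_mul_right _ _)
    rcases Int.even_or_odd' v0 with ⟨k, hk | hk⟩
    · have hk' : (v0:ℤ[X]) = 2*k := by rw [hk]; push_cast; ring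
      have d2 : (2:ℤ[X]) ∣ l*lam := (dvd_add_left (by rw [hk', mul_assoc]; exact dvd_mul_right _ _)).1 d1
      have d3 := (prime_two'.dvd_or_dvd d2).resolve_left m4
      have : lam = q6 l0 l1 0 0 0 0 0 := by rw [hlam]; unfold q6; push_cast; ring
      rw [this, ← two_cast, q6_dvd] at d3
      exact hodd ⟨⟨k, hk⟩, d3.1, d3.2.1⟩
    · have hk' : (v0:ℤ[X]) = 2*k+1 := by rw [hk]; push_cast; ring
      apply h.wk.notin lam dlam
      have : T - A*lam = (T-l*w) - (A-l^2)*lam + (l*lam+v0*w)*l - 2*(l^2*lam+k*l*w) := by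
        rw [hk']; ring
      rw [this]
      exact dvd_sub (dvd_add (dvd_sub m2 (m1.mul_right _)) (d1.mul_right _)) (dvd_mul_right _ _)

theorem noWk : ∀ j : ℕ, 1 ≤ j → ∀ (A T C : ℤ[X]) (n : ℤ), ¬ 2 ∣ n → ¬ Wk A T C (2^j*n) := by
  intro j
  induction j using Nat.strong_induction_on with
  | _ j ih =>
  intro hj A T C n hn hw
  obtain ⟨A, T, C, n, h⟩ := normalizeWk hj ⟨A, T, C, n, hn, hw⟩
  obtain ⟨i, rfl⟩ : ∃ i, j = i+1 := ⟨j-1, by omega⟩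
  obtain ⟨A, C, h, s, hs⟩ := selmer h
  obtain ⟨A1, T1, C1, j', n', h1, h2, h3, h4⟩ := halving h hs
  exact ih j' h2 h1 A1 T1 C1 n' h3 h4

open Polynomial NumberField

theorem no_int {r p Y : ℤ} (hco : IsCoprime r p) (hp0 : p ≠ 0) (hr0 : r ≠ 0) (hrp : r ≠ p)
   (h : Y^2+p^3*Y = r^5*p-2*r^3*p^3+2*r^2*p^4-r*p^5) : False := by
  by_cases hp : 2 ∣ p
  · have hr : ¬ 2 ∣ r := fun hr => by
      have := hco.isUnit_of_dvd' hr hp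
      rw [Int.isUnit_iff] at this; omega
    have hY : Y ≠ 0 := by
      rintro rfl
      have : p*r^5 = p*(2*r^3*p^2-2*r^2*p^3+r*p^4) := by linear_combination -h
      have h5 := mul_left_cancel₀ hp0 this
      apply hr; apply Int.prime_two.dvd_of_dvd_pow (n := 5)
      rw [h5]
      obtain ⟨k, rfl⟩ := hp
      exact ⟨r^3*(2*k)^2-r^2*(2*k)^3+r*8*k^4, by ring⟩
    obtain ⟨a, y, hYa, hy⟩ := two_pow_split hY
    obtain ⟨ha, -, A, T, C, n, hn, hw⟩ := init_even hp hr h hYa hy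
    exact noWk a ha A T C n hn hw
  · by_cases hr : 2 ∣ r
    · obtain ⟨A, T, C, j, n, hj, hn, hw⟩ := init_re hp hr hr0 h
      exact noWk j hj A T C n hn hw
    · obtain ⟨A, T, C, j, n, hj, hn, hw⟩ := init_oo hp hr hrp h
      exact noWk j hj A T C n hn hw

theorem stmt_6 : {p : ℚ × ℚ | -p.1 ^ 3 * p.2 ^ 2 - 2 * p.1 ^ 2 * p.2 + 2 * p.1 * p.2 ^ 2 + p.1 ^ 2 - p.2 ^ 2 - p.1 + p.2 = 0} = ({(0, 0), (0, 1), (1, 0)} : Set (ℚ × ℚ)) := by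
  ext ⟨c, w⟩
  simp only [Set.mem_ofPred_eq, Set.mem_insert_iff, Set.mem_singleton_iff, Prod.mk.injEq]
  constructor
  · intro h
    by_cases hc0 : c = 0
    · subst hc0
      have : w*(1-w) = 0 := by linear_combination h
      rcases mul_eq_zero.1 this with h | h
      · left; exact ⟨rfl, h⟩
      · right; left; exact ⟨rfl, by linarith⟩
    by_cases hc1 : c = 1
    · subst hc1
      right; right; exact ⟨rfl, by linarith⟩
    exfalso
    have hd0 : (c.den:ℤ) ≠ 0 := by exact_mod_cast c.den_nz
    have hn := Rat.mul_den_eq_num c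
    set p : ℤ := (c.den:ℤ) with hp
    set r : ℤ := c.num with hr
    have hn' : c*(p:ℚ) = r := by rw [hp, hr, ← hn]; simp
    set Y : ℚ := p^3*((-c^3+2*c-1)*w-c^2) with hY
    have hYe : Y^2+p^3*Y = r^5*p-2*r^3*p^3+2*r^2*p^4-r*p^5 := by
      rw [hY, ← hn']
      linear_combination (p:ℚ)^6*(-c^3+2*c-1)*h
    obtain ⟨m, hm⟩ := rat_int (x := 2*Y+p^3) (n := p^6+4*(r^5*p-2*r^3*p^3+2*r^2*p^4-r*p^5)) (by
      push_cast; linear_combination 4*hYe)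
    have hm2 : m^2 = p^6+4*(r^5*p-2*r^3*p^3+2*r^2*p^4-r*p^5) := by
      have : (m:ℚ)^2 = p^6+4*(r^5*p-2*r^3*p^3+2*r^2*p^4-r*p^5) := by
        rw [← hm]; linear_combination 4*hYe
      exact_mod_cast this
    have h2 : 2 ∣ m - p^3 := by
      apply Int.prime_two.dvd_of_dvd_pow (n := 2)
      exact ⟨2*(r^5*p-2*r^3*p^3+2*r^2*p^4-r*p^5)-m*p^3+p^6, by linear_combination hm2⟩
    obtain ⟨y, hy⟩ := h2
    have hy' : Y = y := by
      have : (m:ℚ)-p^3 = 2*y := by exact_mod_cast hy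
      linarith
    refine no_int (r := r) (p := p) (Y := y) ?_ hd0 ?_ ?_ ?_
    · rw [Int.isCoprime_iff_gcd_eq_one]
      exact c.reduced
    · exact Rat.num_ne_zero.2 hc0
    · intro e
      apply hc1
      have hp' : (p:ℚ) ≠ 0 := by exact_mod_cast hd0
      apply mul_right_cancel₀ hp'
      rw [hn', e, one_mul]
    · rw [hy'] at hYe; exact_mod_cast hYe
  · rintro (⟨rfl, rfl⟩ | ⟨rfl, rfl⟩ | ⟨rfl, rfl⟩) <;> norm_num
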